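/- Let 1 < p < ∞ and let W be a matrix A_p weight on ℝ^d with reducing operators V_I. Then there is a constant C depending only on p, n, d such that for every ℂ^n-valued function f⃗ with finite Haar expansion, ‖W^{1/p} M_{W,p}^{−1} f⃗‖_{L^p}^p ≤ C ‖W‖_{A_p}^{1 + ⌈p⌉} ‖f⃗‖_{L^p}^p, where M_{W,p}^{−1} f⃗ = ∑_{I ∈ 𝒟} ∑_{ε ∈ 𝒮} V_I^{−1} f⃗_I^ε h_I^ε and ⌈p⌉ is the smallest integer ≥ p. -/

import Mathlib

open MeasureTheory ENNReal
open scoped ComplexOrder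

noncomputable section

/-! ## Basic linear-algebra notation -/

/-- The operator norm of an `n × n` complex matrix, viewed as an operator on the
Euclidean space `ℂⁿ`. -/
def matNorm {n : ℕ} (M : Matrix (Fin n) (Fin n) ℂ) : ℝ :=
  ‖Matrix.toEuclideanCLM (𝕜 := ℂ) (n := Fin n) M‖

/-- A matrix applied to a vector of `ℂⁿ` (with its Euclidean norm). -/
def mApp {n : ℕ} (M : Matrix (Fin n) (Fin n) ℂ) (v : EuclideanSpace ℂ (Fin n)) :
    EuclideanSpace ℂ (Fin n) :=
  Matrix.toEuclideanCLM (𝕜 := ℂ) (n := Fin n) M v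


/-- Entrywise measurability of a matrix-valued function. -/
def MatMeasurable {d n : ℕ} (W : (Fin d → ℝ) → Matrix (Fin n) (Fin n) ℂ) : Prop :=
  ∀ i j, Measurable fun x => W x i j

/-! ## Dyadic cubes and Haar functions -/

/-- A dyadic cube in `ℝ^d`, with side length `2^k` and lower-left corner `(m i * 2^k)_i`. -/
structure DCube (d : ℕ) where
  k : ℤ
  m : Fin d → ℤ

namespace DCube

variable {d : ℕ}

/-- The (half-open) cube in `ℝ^d` determined by a dyadic cube. -/
def set (I : DCube d) : Set (Fin d → ℝ) :=
  {x | ∀ i, (I.m i : ℝ) * 2 ^ I.k ≤ x i ∧ x i < ((I.m i : ℝ) + 1) * 2 ^ I.k}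

/-- The volume `|I| = (2^k)^d` of a dyadic cube. -/
def vol (I : DCube d) : ℝ := ((2 : ℝ) ^ I.k) ^ d

/-- The lower-left corner of a dyadic cube. -/
def corner (I : DCube d) : Fin d → ℝ := fun i => (I.m i : ℝ) * 2 ^ I.k

/-- The side length of a dyadic cube. -/
def side (I : DCube d) : ℝ := (2 : ℝ) ^ I.k

end DCube

/-- One-dimensional Haar functions on the dyadic interval `[m·2^k, (m+1)·2^k)`:
`haar1D true` is the non-cancellative `|I|^{-1/2} χ_I`, while `haar1D false` is
`|I|^{-1/2} (χ_{I_ℓ} - χ_{I_r})`. -/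
def haar1D (ε : Bool) (k mm : ℤ) (t : ℝ) : ℝ :=
  if ε then
    Set.indicator {s : ℝ | (mm : ℝ) * 2 ^ k ≤ s ∧ s < ((mm : ℝ) + 1) * 2 ^ k}
      (fun _ => ((2 : ℝ) ^ k) ^ (-(1 / 2 : ℝ))) t
  else
    Set.indicator {s : ℝ | (mm : ℝ) * 2 ^ k ≤ s ∧ s < (mm : ℝ) * 2 ^ k + 2 ^ (k - 1)}
      (fun _ => ((2 : ℝ) ^ k) ^ (-(1 / 2 : ℝ))) t -
    Set.indicator {s : ℝ | (mm : ℝ) * 2 ^ k + 2 ^ (k - 1) ≤ s ∧ s < ((mm : ℝ) + 1) * 2 ^ k}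
      (fun _ => ((2 : ℝ) ^ k) ^ (-(1 / 2 : ℝ))) t

/-- The signature set `𝒮 = {0,1}^d \ {(1,…,1)}` indexing the cancellative Haar functions. -/
def Sfin (d : ℕ) : Finset (Fin d → Bool) := Finset.univ.erase (fun _ => true)

/-- The Haar function `h_I^ε = ∏ i, h_{I_i}^{ε_i}` associated to a dyadic cube `I ⊂ ℝ^d`
and a signature `ε ∈ {0,1}^d`. -/
def haarFn {d : ℕ} (I : DCube d) (ε : Fin d → Bool) (x : Fin d → ℝ) : ℝ :=
  ∏ i, haar1D (ε i) I.k (I.m i) (x i)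

/-- The (vector of) Haar coefficients `f_I^ε = ∫ f h_I^ε` of a `ℂⁿ`-valued function. -/
def haarCoef {d n : ℕ} (f : (Fin d → ℝ) → EuclideanSpace ℂ (Fin n)) (I : DCube d)
    (ε : Fin d → Bool) : EuclideanSpace ℂ (Fin n) :=
  ∫ x, haarFn I ε x • f x

/-! ## Matrix `A_p` weights and reducing operators -/

/-- The (closed, axis-parallel) cube with corner `c` and side length `r`. -/
def cubeSet {d : ℕ} (c : Fin d → ℝ) (r : ℝ) : Set (Fin d → ℝ) :=
  {x | ∀ i, c i ≤ x i ∧ x i ≤ c i + r}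

/-- The matrix `A_p` characteristic `‖W‖_{A_p}` of a matrix weight `W`, expressed in terms of
`W1p = W^{1/p}` (so that `W^{-1/p} = (W1p)⁻¹`):
`sup_I (1/|I|) ∫_I ((1/|I|) ∫_I ‖W^{1/p}(x) W^{-1/p}(t)‖^{p'} dt)^{p/p'} dx`,
the supremum being over all cubes `I ⊂ ℝ^d`.  Here `p' = p/(p-1)` and `p/p' = p - 1`. -/
def apNorm {d n : ℕ} (p : ℝ) (W1p : (Fin d → ℝ) → Matrix (Fin n) (Fin n) ℂ) : ℝ≥0∞ :=
  ⨆ (c : Fin d → ℝ) (r : ℝ) (_ : 0 < r),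
    (ENNReal.ofReal (r ^ d))⁻¹ *
      ∫⁻ x in cubeSet c r,
        ((ENNReal.ofReal (r ^ d))⁻¹ *
            ∫⁻ t in cubeSet c r,
              ENNReal.ofReal (matNorm (W1p x * (W1p t)⁻¹)) ^ (p / (p - 1))) ^ (p - 1)

/-- The `L^q` average `(|I|^{-1} ∫_I ‖A(x) e‖^q dx)^{1/q}` over a dyadic cube. -/
def redAvgD {d n : ℕ} (q : ℝ) (A : (Fin d → ℝ) → Matrix (Fin n) (Fin n) ℂ) (I : DCube d)
    (e : EuclideanSpace ℂ (Fin n)) : ℝ≥0∞ :=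
  ((ENNReal.ofReal I.vol)⁻¹ * ∫⁻ x in I.set, ENNReal.ofReal ‖mApp (A x) e‖ ^ q) ^ (1 / q)

/-- `V` is a family of reducing operators for the weight `W = (W1p)^p` (indexed by dyadic
cubes), with comparability constants `c₁, c₂`:  each `V I` is positive definite and
`|V_I e| ≈ (|I|^{-1} ∫_I |W^{1/p}(x) e|^p dx)^{1/p}`. -/
def IsReducing {d n : ℕ} (p c₁ c₂ : ℝ) (W1p : (Fin d → ℝ) → Matrix (Fin n) (Fin n) ℂ)
    (V : DCube d → Matrix (Fin n) (Fin n) ℂ) : Prop :=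
  ∀ I : DCube d, (V I).PosDef ∧ ∀ e : EuclideanSpace ℂ (Fin n),
    ENNReal.ofReal c₁ * redAvgD p W1p I e ≤ ENNReal.ofReal ‖mApp (V I) e‖ ∧
    ENNReal.ofReal ‖mApp (V I) e‖ ≤ ENNReal.ofReal c₂ * redAvgD p W1p I e

/-- `V'` is a family of dual reducing operators for the weight `W = (W1p)^p`:
`|V_I' e| ≈ (|I|^{-1} ∫_I |W^{-1/p}(x) e|^{p'} dx)^{1/p'}` with `p' = p/(p-1)`. -/
def IsDualReducing {d n : ℕ} (p c₁ c₂ : ℝ) (W1p : (Fin d → ℝ) → Matrix (Fin n) (Fin n) ℂ)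
    (V' : DCube d → Matrix (Fin n) (Fin n) ℂ) : Prop :=
  ∀ I : DCube d, (V' I).PosDef ∧ ∀ e : EuclideanSpace ℂ (Fin n),
    ENNReal.ofReal c₁ * redAvgD (p / (p - 1)) (fun x => (W1p x)⁻¹) I e ≤
        ENNReal.ofReal ‖mApp (V' I) e‖ ∧
    ENNReal.ofReal ‖mApp (V' I) e‖ ≤
        ENNReal.ofReal c₂ * redAvgD (p / (p - 1)) (fun x => (W1p x)⁻¹) I e

/-- The `L^p(W)` norm `(∫ |W^{1/p}(x) f(x)|^p dx)^{1/p}` (as a value in `[0,∞]`). -/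
def wNorm {d n : ℕ} (p : ℝ) (W1p : (Fin d → ℝ) → Matrix (Fin n) (Fin n) ℂ)
    (f : (Fin d → ℝ) → EuclideanSpace ℂ (Fin n)) : ℝ≥0∞ :=
  (∫⁻ x, ENNReal.ofReal ‖mApp (W1p x) (f x)‖ ^ p) ^ (1 / p)

/-- The square-function expression
`∑_{I ∈ 𝒟} ∑_{ε ∈ 𝒮} |A_I f_I^ε|² |I|^{-1} χ_I(x)` for a family of matrices `A_I`. -/
def sqFn {d n : ℕ} (A : DCube d → Matrix (Fin n) (Fin n) ℂ)
    (f : (Fin d → ℝ) → EuclideanSpace ℂ (Fin n)) (x : Fin d → ℝ) : ℝ≥0∞ :=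
  ∑' I : DCube d, ∑ ε ∈ Sfin d,
    Set.indicator I.set
      (fun _ => ENNReal.ofReal (‖mApp (A I) (haarCoef f I ε)‖ ^ 2) / ENNReal.ofReal I.vol) x

/-! ## Stopping times -/

/-- A stopping time assigns to each dyadic cube `I` a collection `𝒥 I` of pairwise disjoint
dyadic subcubes of `I`. -/
def IsStopping {d : ℕ} (𝒥 : DCube d → Set (DCube d)) : Prop :=
  ∀ I : DCube d, (∀ J ∈ 𝒥 I, J.set ⊆ I.set) ∧
    (𝒥 I).Pairwise fun J K => Disjoint J.set K.set

/-- `ℱ(I)`: the dyadic subcubes of `I` not contained in any stopping cube `J ∈ 𝒥(I)`. -/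
def Fcol {d : ℕ} (𝒥 : DCube d → Set (DCube d)) (I : DCube d) : Set (DCube d) :=
  {J | J.set ⊆ I.set ∧ ∀ K ∈ 𝒥 I, ¬J.set ⊆ K.set}

/-- A stopping time is admissible if `I ∈ ℱ(I)` for every `I`. -/
def Admissible {d : ℕ} (𝒥 : DCube d → Set (DCube d)) : Prop :=
  ∀ I : DCube d, I ∈ Fcol 𝒥 I

/-- The iterated stopping collections: `𝒥^0(I) = {I}` and
`𝒥^{j+1}(I) = ⋃_{J ∈ 𝒥^j(I)} 𝒥(J)`. -/
def JIter {d : ℕ} (𝒥 : DCube d → Set (DCube d)) : ℕ → DCube d → Set (DCube d)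
  | 0, I => {I}
  | j + 1, I => ⋃ J ∈ JIter 𝒥 j I, 𝒥 J

/-- A stopping time is decaying with constant `c` if
`∑_{J ∈ 𝒥(I)} |J| ≤ c |I|` for every `I`. -/
def Decaying {d : ℕ} (c : ℝ) (𝒥 : DCube d → Set (DCube d)) : Prop :=
  ∀ I : DCube d,
    ∑' J : 𝒥 I, ENNReal.ofReal (J : DCube d).vol ≤ ENNReal.ofReal c * ENNReal.ofReal I.vol

/-- `ℱ^j = ℱ^j(I₀) = ⋃_{J ∈ 𝒥^{j-1}(I₀)} ℱ(J)` (intended for `j ≥ 1`). -/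
def Fj {d : ℕ} (𝒥 : DCube d → Set (DCube d)) (I₀ : DCube d) (j : ℕ) : Set (DCube d) :=
  ⋃ J ∈ JIter 𝒥 (j - 1) I₀, Fcol 𝒥 J

/-- The Haar projection `Δ_j f = ∑_{I ∈ ℱ^j} ∑_{ε ∈ 𝒮} f_I^ε h_I^ε`. -/
def deltaHaar {d n : ℕ} (𝒥 : DCube d → Set (DCube d)) (I₀ : DCube d) (j : ℕ)
    (f : (Fin d → ℝ) → EuclideanSpace ℂ (Fin n)) (x : Fin d → ℝ) :
    EuclideanSpace ℂ (Fin n) :=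
  ∑' I : Fj 𝒥 I₀ j, ∑ ε ∈ Sfin d, haarFn (I : DCube d) ε x • haarCoef f (I : DCube d) ε

/-! ## Constant Haar multipliers -/

/-- `∑_{I ∈ S} ∑_{ε ∈ 𝒮} V_I^{-1} f_I^ε h_I^ε(x)`. -/
def projInv {d n : ℕ} (V : DCube d → Matrix (Fin n) (Fin n) ℂ) (S : Set (DCube d))
    (f : (Fin d → ℝ) → EuclideanSpace ℂ (Fin n)) (x : Fin d → ℝ) :
    EuclideanSpace ℂ (Fin n) :=
  ∑' I : S, ∑ ε ∈ Sfin d,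
    haarFn (I : DCube d) ε x • mApp ((V (I : DCube d))⁻¹) (haarCoef f (I : DCube d) ε)

/-- A function has finite Haar expansion if it is a finite sum of Haar functions. -/
def FiniteHaar {d n : ℕ} (f : (Fin d → ℝ) → EuclideanSpace ℂ (Fin n)) : Prop :=
  ∃ F : Finset (DCube d × (Fin d → Bool)),
    ∀ x, f x = ∑ q ∈ F, haarFn q.1 q.2 x • haarCoef f q.1 q.2

/-! ## The weighted stopping time -/

/-- The stopping condition `‖V_J V_I^{-1}‖^p > λ₁` or `‖V_J^{-1} V_I‖^{p'} > λ₂`. -/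
def stopBad {d n : ℕ} (p l₁ l₂ : ℝ) (V : DCube d → Matrix (Fin n) (Fin n) ℂ)
    (J I : DCube d) : Prop :=
  l₁ < matNorm (V J * (V I)⁻¹) ^ p ∨ l₂ < matNorm ((V J)⁻¹ * V I) ^ (p / (p - 1))

/-- The stopping time `𝒥(I)` = maximal dyadic subcubes `J ⊆ I` satisfying `stopBad`. -/
def stopST {d n : ℕ} (p l₁ l₂ : ℝ) (V : DCube d → Matrix (Fin n) (Fin n) ℂ)
    (I : DCube d) : Set (DCube d) :=
  {J | J.set ⊆ I.set ∧ stopBad p l₁ l₂ V J I ∧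
    ∀ K : DCube d, K.set ⊆ I.set → stopBad p l₁ l₂ V K I → J.set ⊆ K.set → K = J}

namespace DCube

variable {d : ℕ}

lemma vol_pos (K : DCube d) : 0 < K.vol := by unfold vol; positivity

/-- The volume of a dyadic cube as an extended nonnegative real. -/
def evol (K : DCube d) : ℝ≥0∞ := ENNReal.ofReal K.vol

lemma evol_ne_zero (K : DCube d) : K.evol ≠ 0 := by
  simpa [evol] using K.vol_pos

lemma evol_ne_top (K : DCube d) : K.evol ≠ ⊤ := ENNReal.ofReal_ne_top

lemma set_eq_pi (K : DCube d) :
    K.set = Set.univ.pi fun i => Set.Ico ((K.m i : ℝ) * 2 ^ K.k) (((K.m i : ℝ) + 1) * 2 ^ K.k) := by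
  ext x; simp [set]

lemma measurableSet_set (K : DCube d) : MeasurableSet K.set := by
  rw [set_eq_pi]
  exact MeasurableSet.univ_pi fun i => measurableSet_Ico

lemma volume_set (K : DCube d) : volume K.set = K.evol := by
  rw [set_eq_pi, Real.volume_pi_Ico, evol, vol, ← ENNReal.ofReal_prod_of_nonneg]
  · congr 1
    rw [Finset.prod_congr rfl (g := fun _ => (2 : ℝ) ^ K.k) (fun i _ => by ring)]
    simp
  · intro i _
    have : (0 : ℝ) < 2 ^ K.k := by positivity
    nlinarith

lemma set_subset_cubeSet (K : DCube d) : K.set ⊆ cubeSet K.corner K.side := by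
  intro x hx i
  have := hx i
  refine ⟨this.1, ?_⟩
  have h2 := this.2
  simp only [corner, side]
  linarith

/-- The dyadic child of `K` selected by `s`: in the `i`th coordinate the upper half is chosen
iff `s i = true`. -/
def child (K : DCube d) (s : Fin d → Bool) : DCube d :=
  ⟨K.k - 1, fun i => 2 * K.m i + if s i then 1 else 0⟩

/-- The selector of the child of `K` containing a point of `K`. -/
def kidSel (K : DCube d) (x : Fin d → ℝ) : Fin d → Bool :=
  fun i => decide ((K.m i : ℝ) * 2 ^ K.k + 2 ^ (K.k - 1) ≤ x i)

/-- The child of `K` containing a point of `K`. -/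
def kid (K : DCube d) (x : Fin d → ℝ) : DCube d := K.child (K.kidSel x)

lemma two_zpow_eq (k : ℤ) : (2 : ℝ) ^ k = 2 * 2 ^ (k - 1) := by
  rw [zpow_sub_one₀ (by norm_num)]; ring

lemma mem_child_iff {K : DCube d} {s : Fin d → Bool} {x : Fin d → ℝ} :
    x ∈ (K.child s).set ↔ x ∈ K.set ∧ s = K.kidSel x := by
  have hh : (0 : ℝ) < 2 ^ (K.k - 1) := by positivity
  simp only [set, Set.mem_ofPred_eq, funext_iff, ← forall_and]
  refine forall_congr' fun i => ?_
  simp only [child, kidSel, two_zpow_eq K.k]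
  generalize (2 : ℝ) ^ (K.k - 1) = h at *
  cases hs : s i
  · simp only [Bool.false_eq_true, if_false, false_eq_decide_iff, not_le]
    push_cast
    constructor
    · rintro ⟨h1, h2⟩; refine ⟨⟨?_, ?_⟩, ?_⟩ <;> nlinarith
    · rintro ⟨⟨h1, h2⟩, h3⟩; refine ⟨?_, ?_⟩ <;> nlinarith
  · simp only [if_true, true_eq_decide_iff]
    push_cast
    constructor
    · rintro ⟨h1, h2⟩; refine ⟨⟨?_, ?_⟩, ?_⟩ <;> nlinarith
    · rintro ⟨⟨h1, h2⟩, h3⟩; refine ⟨?_, ?_⟩ <;> nlinarith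

lemma child_set_subset (K : DCube d) (s : Fin d → Bool) : (K.child s).set ⊆ K.set :=
  fun _ hx => (mem_child_iff.1 hx).1

lemma kidSel_of_mem {K : DCube d} {s : Fin d → Bool} {x : Fin d → ℝ}
    (hx : x ∈ (K.child s).set) : K.kidSel x = s := (mem_child_iff.1 hx).2.symm

lemma kid_of_mem {K : DCube d} {s : Fin d → Bool} {x : Fin d → ℝ}
    (hx : x ∈ (K.child s).set) : K.kid x = K.child s := by rw [kid, kidSel_of_mem hx]

lemma mem_kid {K : DCube d} {x : Fin d → ℝ} (hx : x ∈ K.set) : x ∈ (K.kid x).set :=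
  mem_child_iff.2 ⟨hx, rfl⟩

lemma iUnion_child (K : DCube d) : ⋃ s, (K.child s).set = K.set := by
  ext x; simp [mem_child_iff]

lemma pairwise_disjoint_child (K : DCube d) :
    Pairwise (Function.onFun Disjoint fun s => (K.child s).set) := by
  intro s t hst
  refine Set.disjoint_left.2 fun x hs ht => hst ?_
  rw [(mem_child_iff.1 hs).2, (mem_child_iff.1 ht).2]

lemma measurable_kidSel (K : DCube d) : Measurable K.kidSel := by
  refine measurable_pi_lambda _ fun i => ?_
  simp only [kidSel]
  exact measurable_to_bool (by
    have : (fun c : Fin d → ℝ => decide ((K.m i : ℝ) * 2 ^ K.k + 2 ^ (K.k - 1) ≤ c i)) ⁻¹' {true}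
      = {c | (K.m i : ℝ) * 2 ^ K.k + 2 ^ (K.k - 1) ≤ c i} := by ext; simp
    rw [this]
    exact measurableSet_le measurable_const (measurable_pi_apply i))

lemma measurable_glue {β : Type*} [MeasurableSpace β] (K : DCube d)
    {F : (Fin d → Bool) → (Fin d → ℝ) → β} (hF : ∀ s, Measurable (F s)) :
    Measurable fun x => F (K.kidSel x) x :=
  (measurable_from_prod_countable_right (f := fun q : (Fin d → Bool) × (Fin d → ℝ) => F q.1 q.2)
    hF).comp (K.measurable_kidSel.prodMk measurable_id)

lemma setLIntegral_eq_sum_child (K : DCube d) (g : (Fin d → ℝ) → ℝ≥0∞) :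
    ∫⁻ x in K.set, g x = ∑ s, ∫⁻ x in (K.child s).set, g x := by
  rw [← iUnion_child, lintegral_iUnion (fun s => (K.child s).measurableSet_set)
    K.pairwise_disjoint_child, tsum_fintype]

lemma setLIntegral_glue (K : DCube d) (F : (Fin d → Bool) → (Fin d → ℝ) → ℝ≥0∞) :
    ∫⁻ x in K.set, F (K.kidSel x) x = ∑ s, ∫⁻ x in (K.child s).set, F s x := by
  rw [setLIntegral_eq_sum_child]
  refine Finset.sum_congr rfl fun s _ => ?_
  exact setLIntegral_congr_fun (K.child s).measurableSet_set fun x hx => by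
    simp only [kidSel_of_mem hx]

lemma setIntegral_eq_sum_child {E : Type*} [NormedAddCommGroup E] [NormedSpace ℝ E]
    (K : DCube d) {g : (Fin d → ℝ) → E} (hg : IntegrableOn g K.set) :
    ∫ x in K.set, g x = ∑ s, ∫ x in (K.child s).set, g x := by
  rw [← iUnion_child, integral_iUnion_fintype (fun s => (K.child s).measurableSet_set)
    K.pairwise_disjoint_child fun s => hg.mono_set (K.child_set_subset s)]

lemma vol_child (K : DCube d) (s : Fin d → Bool) : K.vol = 2 ^ d * (K.child s).vol := by
  simp only [vol, child]
  rw [two_zpow_eq K.k, mul_pow]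

lemma sum_vol_child (K : DCube d) : ∑ s, (K.child s).vol = K.vol := by
  have : ∀ s, (K.child s).vol = K.vol / 2 ^ d := fun s => by
    rw [K.vol_child s]; field_simp
  simp only [this, Finset.sum_const, Finset.card_univ, Fintype.card_fun, Fintype.card_bool,
    Fintype.card_fin, nsmul_eq_mul]
  push_cast
  field_simp

/-- The dyadic cube of side `2^k` containing `x`. -/
def cubeAt (k : ℤ) (x : Fin d → ℝ) : DCube d := ⟨k, fun i => ⌊x i / 2 ^ k⌋⟩

lemma mem_set_iff {K : DCube d} {x : Fin d → ℝ} : x ∈ K.set ↔ K = cubeAt K.k x := by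
  have hk : (0 : ℝ) < 2 ^ K.k := by positivity
  have : K = cubeAt K.k x ↔ ∀ i, K.m i = ⌊x i / 2 ^ K.k⌋ := by
    cases K; simp [cubeAt, funext_iff]
  rw [this]
  refine forall_congr' fun i => ?_
  rw [eq_comm, Int.floor_eq_iff, le_div_iff₀ hk, div_lt_iff₀ hk]

lemma mem_cubeAt (k : ℤ) (x : Fin d → ℝ) : x ∈ (cubeAt k x).set := mem_set_iff.2 rfl

lemma kid_cubeAt (k : ℤ) (x : Fin d → ℝ) : (cubeAt k x).kid x = cubeAt (k - 1) x :=
  mem_set_iff.1 (mem_kid (mem_cubeAt k x))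

lemma measurable_cubeAt_comp {β : Type*} [MeasurableSpace β] (k : ℤ)
    {F : DCube d → (Fin d → ℝ) → β} (hF : ∀ K, Measurable (F K)) :
    Measurable fun x => F (cubeAt k x) x := by
  have h1 : Measurable fun x : Fin d → ℝ => fun i => ⌊x i / 2 ^ k⌋ :=
    measurable_pi_lambda _ fun i => ((measurable_pi_apply i).div_const _).floor
  exact (measurable_from_prod_countable_right
    (f := fun q : (Fin d → ℤ) × (Fin d → ℝ) => F ⟨k, q.1⟩ q.2) fun m => hF ⟨k, m⟩).comp
    (h1.prodMk measurable_id)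

lemma lintegral_eq_tsum_cube (k : ℤ) (F : DCube d → (Fin d → ℝ) → ℝ≥0∞) :
    ∫⁻ x, F (cubeAt k x) x = ∑' m : Fin d → ℤ, ∫⁻ x in (⟨k, m⟩ : DCube d).set, F ⟨k, m⟩ x := by
  have hU : ⋃ m : Fin d → ℤ, (⟨k, m⟩ : DCube d).set = Set.univ :=
    Set.eq_univ_of_forall fun x => Set.mem_iUnion.2 ⟨_, mem_cubeAt k x⟩
  have hD : Pairwise (Function.onFun Disjoint fun m : Fin d → ℤ => (⟨k, m⟩ : DCube d).set) := by
    intro s t hst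
    refine Set.disjoint_left.2 fun x hs ht => hst ?_
    have := (mem_set_iff.1 hs).trans (mem_set_iff.1 ht).symm
    injection this
  rw [← setLIntegral_univ, ← hU, lintegral_iUnion (fun m => measurableSet_set _) hD]
  refine tsum_congr fun m => setLIntegral_congr_fun (measurableSet_set _) fun x hx => ?_
  have := mem_set_iff.1 hx
  simp only at this ⊢
  rw [← this]

/-- The average of a vector-valued function over a dyadic cube. -/
def avg {E : Type*} [NormedAddCommGroup E] [NormedSpace ℝ E] (K : DCube d)
    (g : (Fin d → ℝ) → E) : E := (K.vol)⁻¹ • ∫ x in K.set, g x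

end DCube

lemma haar1D_const_mul_self (k : ℤ) :
    ((2 : ℝ) ^ k) ^ (-(1 / 2 : ℝ)) * ((2 : ℝ) ^ k) ^ (-(1 / 2 : ℝ)) = ((2 : ℝ) ^ k)⁻¹ := by
  rw [← Real.rpow_add (by positivity), ← Real.rpow_neg_one]
  norm_num

lemma haar1D_kernel (k m : ℤ) {t : ℝ} (s : ℝ) (ht : (m : ℝ) * 2 ^ k ≤ t ∧ t < ((m : ℝ) + 1) * 2 ^ k) :
    haar1D true k m t * haar1D true k m s + haar1D false k m t * haar1D false k m s =
      if (((2 * m + if decide ((m : ℝ) * 2 ^ k + 2 ^ (k - 1) ≤ t) then 1 else 0 : ℤ) : ℝ)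
          * 2 ^ (k - 1) ≤ s ∧
        s < (((2 * m + if decide ((m : ℝ) * 2 ^ k + 2 ^ (k - 1) ≤ t) then 1 else 0 : ℤ) : ℝ) + 1)
          * 2 ^ (k - 1)) then ((2 : ℝ) ^ (k - 1))⁻¹ else 0 := by
  have hc := haar1D_const_mul_self k
  have hh : (0 : ℝ) < 2 ^ (k - 1) := by positivity
  simp only [haar1D, if_true, Bool.false_eq_true, if_false, Set.indicator_apply,
    Set.mem_ofPred_eq]
  generalize ((2 : ℝ) ^ k) ^ (-(1 / 2 : ℝ)) = c at *
  rw [DCube.two_zpow_eq k] at *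
  generalize (2 : ℝ) ^ (k - 1) = h at *
  have hi : h⁻¹ = c * c + c * c := by rw [hc]; field_simp; norm_num
  rw [hi]
  obtain ⟨h1, h2⟩ := ht
  by_cases h3 : (m : ℝ) * (2 * h) + h ≤ t
  · simp only [h1, h2, h3, not_lt.2 h3, and_self, and_false, if_true, if_false, decide_true]
    push_cast
    have e1 : (2 * (m : ℝ) + 1) * h = m * (2 * h) + h := by ring
    have e2 : (2 * (m : ℝ) + 1 + 1) * h = (m + 1) * (2 * h) := by ring
    rw [e1, e2]
    by_cases a1 : (m : ℝ) * (2 * h) ≤ s <;> by_cases a2 : s < ((m : ℝ) + 1) * (2 * h) <;>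
      by_cases a3 : (m : ℝ) * (2 * h) + h ≤ s
    all_goals first | (exfalso; nlinarith) | simp [a1, a2, a3, not_lt.2, not_le.1]
  · have h3' := not_le.1 h3
    simp only [h1, h2, h3, h3', and_self, false_and, if_true, if_false, decide_false,
      Bool.false_eq_true]
    push_cast
    have e1 : (2 * (m : ℝ) + 0) * h = m * (2 * h) := by ring
    have e2 : (2 * (m : ℝ) + 0 + 1) * h = m * (2 * h) + h := by ring
    rw [e1, e2]
    by_cases a1 : (m : ℝ) * (2 * h) ≤ s <;> by_cases a2 : s < ((m : ℝ) + 1) * (2 * h) <;>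
      by_cases a3 : (m : ℝ) * (2 * h) + h ≤ s
    all_goals first | (exfalso; nlinarith) | simp [a1, a2, a3, not_lt.2, not_le.1]

section HaarFunctions

variable {d n : ℕ}

open DCube

lemma sum_haarFn_mul (K : DCube d) {x : Fin d → ℝ} (hx : x ∈ K.set) (y : Fin d → ℝ) :
    ∑ ε : Fin d → Bool, haarFn K ε x * haarFn K ε y =
      (K.kid x).set.indicator (fun _ => ((K.kid x).vol)⁻¹) y := by
  classical
  simp only [haarFn, ← Finset.prod_mul_distrib]
  rw [← Fintype.prod_sum fun i (e : Bool) =>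
    haar1D e K.k (K.m i) (x i) * haar1D e K.k (K.m i) (y i)]
  simp only [Fintype.sum_bool]
  rw [Finset.prod_congr rfl fun i _ => haar1D_kernel K.k (K.m i) (y i) (hx i)]
  rw [Finset.prod_ite_zero]
  simp only [Set.indicator_apply, Finset.mem_univ, true_imp_iff, Finset.prod_const,
    Finset.card_univ, Fintype.card_fin]
  simp [kid, child, DCube.set, kidSel, vol]

lemma haarFn_true (K : DCube d) (x : Fin d → ℝ) :
    haarFn K (fun _ => true) x =
      K.set.indicator (fun _ => (((2 : ℝ) ^ K.k) ^ (-(1 / 2 : ℝ))) ^ d) x := by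
  classical
  simp only [haarFn, haar1D, if_true, Set.indicator_apply, Set.mem_ofPred_eq]
  rw [Finset.prod_ite_zero]
  simp [DCube.set]

lemma sum_Sfin_haarFn_mul (K : DCube d) {x : Fin d → ℝ} (hx : x ∈ K.set) (y : Fin d → ℝ) :
    ∑ ε ∈ Sfin d, haarFn K ε x * haarFn K ε y =
      (K.kid x).set.indicator (fun _ => ((K.kid x).vol)⁻¹) y -
        K.set.indicator (fun _ => (K.vol)⁻¹) y := by
  rw [← sum_haarFn_mul K hx, Sfin, eq_sub_iff_add_eq']
  rw [← Finset.add_sum_erase _ _ (Finset.mem_univ (fun _ => true))]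
  congr 1
  rw [haarFn_true, haarFn_true, Set.indicator_of_mem hx]
  by_cases hy : y ∈ K.set
  · rw [Set.indicator_of_mem hy, Set.indicator_of_mem hy, ← mul_pow, haar1D_const_mul_self, vol,
      inv_pow]
  · rw [Set.indicator_of_notMem hy, Set.indicator_of_notMem hy, mul_zero]

lemma haar1D_eq_zero {ε : Bool} {k m : ℤ} {t : ℝ}
    (ht : ¬((m : ℝ) * 2 ^ k ≤ t ∧ t < ((m : ℝ) + 1) * 2 ^ k)) : haar1D ε k m t = 0 := by
  have hh : (0 : ℝ) < 2 ^ (k - 1) := by positivity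
  rw [two_zpow_eq k] at ht
  cases ε <;> simp only [haar1D, Set.indicator_apply, Set.mem_ofPred_eq, two_zpow_eq k,
    Bool.false_eq_true, if_true, if_false]
  · generalize (2 : ℝ) ^ (k - 1) = h at *
    rw [if_neg, if_neg, sub_zero]
    · rintro ⟨h1, h2⟩; exact ht ⟨by linarith, h2⟩
    · rintro ⟨h1, h2⟩; exact ht ⟨h1, by linarith⟩
  · rw [if_neg ht]

lemma haarFn_eq_zero {K : DCube d} {ε : Fin d → Bool} {x : Fin d → ℝ} (hx : x ∉ K.set) :
    haarFn K ε x = 0 := by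
  simp only [DCube.set, Set.mem_ofPred_eq, not_forall] at hx
  obtain ⟨i, hi⟩ := hx
  exact Finset.prod_eq_zero (Finset.mem_univ i) (haar1D_eq_zero hi)

lemma measurable_haar1D (ε : Bool) (k m : ℤ) : Measurable (haar1D ε k m) := by
  unfold haar1D
  cases ε
  · simp only [Bool.false_eq_true, if_false]
    exact (measurable_const.indicator measurableSet_Ico).sub
      (measurable_const.indicator measurableSet_Ico)
  · simp only [if_true]
    exact measurable_const.indicator measurableSet_Ico

lemma measurable_haarFn (K : DCube d) (ε : Fin d → Bool) : Measurable (haarFn K ε) :=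
  Finset.measurable_prod _ fun i _ => (measurable_haar1D _ _ _).comp (measurable_pi_apply i)

lemma abs_haar1D_le (ε : Bool) (k m : ℤ) (t : ℝ) :
    |haar1D ε k m t| ≤ 2 * ((2 : ℝ) ^ k) ^ (-(1 / 2 : ℝ)) := by
  have hc : (0 : ℝ) ≤ ((2 : ℝ) ^ k) ^ (-(1 / 2 : ℝ)) := by positivity
  simp only [haar1D, Set.indicator_apply]
  generalize ((2 : ℝ) ^ k) ^ (-(1 / 2 : ℝ)) = c at *
  split_ifs <;> rw [abs_le] <;> constructor <;> linarith

lemma abs_haarFn_le (K : DCube d) (ε : Fin d → Bool) (x : Fin d → ℝ) :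
    |haarFn K ε x| ≤ (2 * ((2 : ℝ) ^ K.k) ^ (-(1 / 2 : ℝ))) ^ d := by
  rw [haarFn, Finset.abs_prod]
  calc _ ≤ ∏ _i : Fin d, 2 * ((2 : ℝ) ^ K.k) ^ (-(1 / 2 : ℝ)) :=
        Finset.prod_le_prod (fun _ _ => abs_nonneg _) fun i _ => abs_haar1D_le _ _ _ _
    _ = _ := by simp

lemma integrable_haarFn (K : DCube d) (ε : Fin d → Bool) : Integrable (haarFn K ε) := by
  have : haarFn K ε = K.set.indicator (haarFn K ε) := by
    ext x
    by_cases hx : x ∈ K.set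
    · rw [Set.indicator_of_mem hx]
    · rw [Set.indicator_of_notMem hx, haarFn_eq_zero hx]
  rw [this, integrable_indicator_iff K.measurableSet_set]
  exact Measure.integrableOn_of_bounded (by rw [volume_set]; exact K.evol_ne_top)
    (measurable_haarFn K ε).aestronglyMeasurable (.of_forall fun x => abs_haarFn_le K ε x)

lemma sum_haarFn_smul {E : Type*} [NormedAddCommGroup E] [NormedSpace ℝ E] [CompleteSpace E]
    {f : (Fin d → ℝ) → E} (hf : Integrable f) (K : DCube d) {x : Fin d → ℝ} (hx : x ∈ K.set) :
    ∑ ε ∈ Sfin d, haarFn K ε x • ∫ y, haarFn K ε y • f y = (K.kid x).avg f - K.avg f := by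
  have hI : ∀ ε, Integrable fun y => haarFn K ε y • f y := fun ε =>
    hf.bdd_smul _ (measurable_haarFn K ε).aestronglyMeasurable
      (.of_forall fun x => abs_haarFn_le K ε x)
  simp only [← integral_smul]
  have hI' : ∀ ε ∈ Sfin d, Integrable fun y => haarFn K ε x • haarFn K ε y • f y :=
    fun ε _ => (hI ε).smul (haarFn K ε x)
  rw [← integral_finsetSum _ hI']
  simp only [smul_smul, ← Finset.sum_smul, sum_Sfin_haarFn_mul K hx, sub_smul]
  have key : ∀ L : DCube d, (fun y => L.set.indicator (fun _ => (L.vol)⁻¹) y • f y) =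
      L.set.indicator fun y => (L.vol)⁻¹ • f y := by
    intro L; ext y
    by_cases hy : y ∈ L.set <;> simp [hy]
  have hL : ∀ L : DCube d, Integrable fun y => L.set.indicator (fun _ => (L.vol)⁻¹) y • f y := by
    intro L
    rw [key]
    exact (hf.smul (L.vol)⁻¹).indicator L.measurableSet_set
  rw [integral_sub (hL _) (hL _), key, key, integral_indicator (measurableSet_set _),
    integral_indicator (measurableSet_set _), integral_smul, integral_smul]
  rfl

lemma sum_haarFn_smul_mApp {f : (Fin d → ℝ) → EuclideanSpace ℂ (Fin n)} (hf : Integrable f)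
    (A : Matrix (Fin n) (Fin n) ℂ) (K : DCube d) (x : Fin d → ℝ) :
    ∑ ε ∈ Sfin d, haarFn K ε x • mApp A (haarCoef f K ε) =
      K.set.indicator (fun x => mApp A ((K.kid x).avg f - K.avg f)) x := by
  by_cases hx : x ∈ K.set
  · rw [Set.indicator_of_mem hx, ← sum_haarFn_smul hf K hx]
    unfold mApp
    rw [map_sum]
    refine Finset.sum_congr rfl fun ε _ => ?_
    exact ((Matrix.toEuclideanCLM (𝕜 := ℂ) (n := Fin n) A).map_smul_of_tower _ _).symm
  · rw [Set.indicator_of_notMem hx]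
    exact Finset.sum_eq_zero fun ε _ => by rw [haarFn_eq_zero hx, zero_smul]

end HaarFunctions

namespace DCube

variable {d : ℕ} (bad : DCube d → DCube d → Prop)

lemma setLIntegral_kid (K : DCube d) (F : DCube d → (Fin d → ℝ) → ℝ≥0∞) :
    ∫⁻ x in K.set, F (K.kid x) x = ∑ s, ∫⁻ x in (K.child s).set, F (K.child s) x :=
  setLIntegral_glue K fun s => F (K.child s)

open Classical in
/-- The principal cube of a cube `L` whose parent has principal cube `Q`. -/
def principal (Q L : DCube d) : DCube d := if bad L Q then L else Q

open Classical in
/-- The number of principal cubes strictly below `K` (down to `m` generations) which contain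
`x`, where `Q` is the principal cube of `K`. -/
def stopCount : ℕ → DCube d → DCube d → (Fin d → ℝ) → ℕ
  | 0, _, _, _ => 0
  | m + 1, Q, K, x =>
    (if bad (K.kid x) Q then 1 else 0) + stopCount m (principal bad Q (K.kid x)) (K.kid x) x

open Classical in
/-- The sum of `g L x` over the principal cubes `L ∋ x` strictly below `K`. -/
def stopFun (g : DCube d → (Fin d → ℝ) → ℝ≥0∞) :
    ℕ → DCube d → DCube d → (Fin d → ℝ) → ℝ≥0∞
  | 0, _, _, _ => 0
  | m + 1, Q, K, x =>
    (if bad (K.kid x) Q then g (K.kid x) x else 0) +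
      stopFun g m (principal bad Q (K.kid x)) (K.kid x) x

open Classical in
/-- The sum of `t L` over the principal cubes `L` strictly below `K`. -/
def stopSum {M : Type*} [AddCommMonoid M] (t : DCube d → M) : ℕ → DCube d → DCube d → M
  | 0, _, _ => 0
  | m + 1, Q, K => ∑ s, ((if bad (K.child s) Q then t (K.child s) else 0) +
      stopSum t m (principal bad Q (K.child s)) (K.child s))

open Classical in
/-- The union of the maximal cubes below `K` that are bad with respect to `Q`. -/
def badSet : ℕ → DCube d → DCube d → Set (Fin d → ℝ)
  | 0, _, _ => ∅
  | m + 1, Q, K => ⋃ s, if bad (K.child s) Q then (K.child s).set else badSet m Q (K.child s)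

variable {bad}

lemma badSet_subset (m : ℕ) (Q K : DCube d) : badSet bad m Q K ⊆ K.set := by
  induction m generalizing K with
  | zero => simp [badSet]
  | succ m ih =>
    simp only [badSet]
    refine Set.iUnion_subset fun s => ?_
    split_ifs
    · exact K.child_set_subset s
    · exact (ih _).trans (K.child_set_subset s)

lemma measurableSet_badSet (m : ℕ) (Q K : DCube d) : MeasurableSet (badSet bad m Q K) := by
  induction m generalizing K with
  | zero => simp [badSet]
  | succ m ih =>
    simp only [badSet]
    refine MeasurableSet.iUnion fun s => ?_
    split_ifs
    · exact measurableSet_set _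
    · exact ih _

open Classical in
lemma setLIntegral_badSet_succ (m : ℕ) (Q K : DCube d) (w : (Fin d → ℝ) → ℝ≥0∞) :
    ∫⁻ x in badSet bad (m + 1) Q K, w x =
      ∑ s, if bad (K.child s) Q then ∫⁻ x in (K.child s).set, w x
        else ∫⁻ x in badSet bad m Q (K.child s), w x := by
  simp only [badSet]
  rw [lintegral_iUnion, tsum_fintype]
  · refine Finset.sum_congr rfl fun s _ => ?_
    split_ifs <;> rfl
  · intro s
    split_ifs
    · exact measurableSet_set _
    · exact measurableSet_badSet _ _ _
  · intro s t hst
    refine (K.pairwise_disjoint_child hst).mono ?_ ?_ <;>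
    · simp only
      split_ifs
      · exact subset_rfl
      · exact badSet_subset _ _ _

lemma mul_volume_badSet_le {c : ℝ≥0∞} {Q : DCube d} {H : (Fin d → ℝ) → ℝ≥0∞}
    (h : ∀ L, bad L Q → c * L.evol ≤ ∫⁻ x in L.set, H x) (m : ℕ) (K : DCube d) :
    c * volume (badSet bad m Q K) ≤ ∫⁻ x in badSet bad m Q K, H x := by
  classical
  induction m generalizing K with
  | zero => simp [badSet]
  | succ m ih =>
    have h1 := setLIntegral_badSet_succ (bad := bad) m Q K (fun _ => 1)
    simp only [lintegral_one, Measure.restrict_apply_univ] at h1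
    rw [h1, setLIntegral_badSet_succ, Finset.mul_sum]
    refine Finset.sum_le_sum fun s _ => ?_
    split_ifs with hb
    · rw [volume_set]; exact h _ hb
    · exact ih _

lemma lintegral_pow_stopCount_le {r : ℝ≥0∞} {w : (Fin d → ℝ) → ℝ≥0∞}
    (hw : ∀ (K : DCube d) (E : Set (Fin d → ℝ)), MeasurableSet E → E ⊆ K.set →
      2 * volume E ≤ K.evol → (1 + r) * ∫⁻ x in E, w x ≤ ∫⁻ x in K.set, w x)
    (hS : ∀ m (Q : DCube d), 2 * volume (badSet bad m Q Q) ≤ Q.evol) {θ : ℝ≥0∞}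
    (hθ : θ * 2 = 2 + r) (hθt : θ ≠ ⊤) (m : ℕ) (Q K : DCube d) :
    ∫⁻ x in K.set, θ ^ stopCount bad m Q K x * w x ≤
      (∫⁻ x in K.set, w x) + (1 + r) * ∫⁻ x in badSet bad m Q K, w x := by
  classical
  induction m generalizing Q K with
  | zero => simp [stopCount]
  | succ m ih =>
    simp only [stopCount]
    rw [setLIntegral_kid K fun L x => θ ^ ((if bad L Q then 1 else 0) +
      stopCount bad m (principal bad Q L) L x) * w x,
      setLIntegral_badSet_succ, setLIntegral_eq_sum_child K w, Finset.mul_sum,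
      ← Finset.sum_add_distrib]
    refine Finset.sum_le_sum fun s _ => ?_
    by_cases hb : bad (K.child s) Q
    · simp only [hb, if_true, principal, pow_add, pow_one, mul_assoc]
      rw [lintegral_const_mul' _ _ hθt]
      calc θ * _ ≤ θ * ((∫⁻ x in (K.child s).set, w x) + ∫⁻ x in (K.child s).set, w x) := by
            gcongr
            refine (ih _ _).trans ?_
            gcongr
            exact hw _ _ (measurableSet_badSet _ _ _) (badSet_subset _ _ _) (hS _ _)
        _ = (θ * 2) * ∫⁻ x in (K.child s).set, w x := by ring
        _ = _ := by rw [hθ, ← one_add_one_eq_two]; ring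
    · simp only [hb, if_false, principal, zero_add]
      exact ih _ _

lemma setLIntegral_stopFun_mul {g : DCube d → (Fin d → ℝ) → ℝ≥0∞} (hg : ∀ L, Measurable (g L))
    {ψ : (Fin d → ℝ) → ℝ≥0∞} (hψ : Measurable ψ) (m : ℕ) (Q K : DCube d) :
    ∫⁻ x in K.set, stopFun bad g m Q K x * ψ x =
      stopSum bad (fun L => ∫⁻ x in L.set, g L x * ψ x) m Q K := by
  classical
  induction m generalizing Q K with
  | zero => simp [stopFun, stopSum]
  | succ m ih =>
    simp only [stopFun, stopSum]
    rw [setLIntegral_kid K fun L x => ((if bad L Q then g L x else 0) +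
      stopFun bad g m (principal bad Q L) L x) * ψ x]
    refine Finset.sum_congr rfl fun s _ => ?_
    rw [← ih]
    by_cases hb : bad (K.child s) Q
    · simp only [hb, if_true, add_mul]
      exact lintegral_add_left ((hg _).mul hψ) _
    · simp [hb]

lemma measurable_stopFun {g : DCube d → (Fin d → ℝ) → ℝ≥0∞} (hg : ∀ L, Measurable (g L))
    (m : ℕ) (Q K : DCube d) : Measurable (stopFun bad g m Q K) := by
  classical
  induction m generalizing Q K with
  | zero => exact measurable_const
  | succ m ih =>
    refine measurable_glue K (F := fun s x => (if bad (K.child s) Q then g (K.child s) x else 0) +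
      stopFun bad g m (principal bad Q (K.child s)) (K.child s) x) fun s => ?_
    refine Measurable.add ?_ (ih _ _)
    split_ifs
    · exact hg _
    · exact measurable_const

lemma measurable_stopCount (m : ℕ) (Q K : DCube d) :
    Measurable (stopCount bad m Q K) := by
  classical
  induction m generalizing Q K with
  | zero => exact measurable_const
  | succ m ih =>
    exact measurable_glue K (F := fun s x => (if bad (K.child s) Q then 1 else 0) +
      stopCount bad m (principal bad Q (K.child s)) (K.child s) x)
        fun s => measurable_const.add (ih _ _)
end DCube

lemma ENNReal.add_rpow_le_weighted {q : ℝ} (hq : 1 ≤ q) {w₁ w₂ : ℝ≥0∞} (hw : w₁ + w₂ = 1)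
    (h₁ : w₁ ≠ 0) (h₂ : w₂ ≠ 0) (s a : ℝ≥0∞) :
    (s + a) ^ q ≤ w₁ ^ (1 - q) * s ^ q + w₂ ^ (1 - q) * a ^ q := by
  have key : ∀ w : ℝ≥0∞, w ≤ 1 → w ≠ 0 → ∀ z : ℝ≥0∞,
      w * (w⁻¹ * z) = z ∧ w * (w⁻¹ * z) ^ q = w ^ (1 - q) * z ^ q := by
    intro w hw hw0 z
    have ht : w ≠ ⊤ := (hw.trans_lt one_lt_top).ne
    refine ⟨by rw [← mul_assoc, ENNReal.mul_inv_cancel hw0 ht, one_mul], ?_⟩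
    rw [ENNReal.mul_rpow_of_nonneg _ _ (by linarith), ← mul_assoc, ENNReal.inv_rpow,
      ← ENNReal.rpow_neg, sub_eq_add_neg, ENNReal.rpow_add _ _ hw0 ht, ENNReal.rpow_one]
  have k₁ := key w₁ (hw ▸ le_self_add) h₁ s
  have k₂ := key w₂ (hw ▸ le_add_self) h₂ a
  have := ENNReal.rpow_arith_mean_le_arith_mean2_rpow w₁ w₂ (w₁⁻¹ * s) (w₂⁻¹ * a) hw hq
  rwa [k₁.1, k₂.1, k₁.2, k₂.2] at this

lemma Real.one_sub_rpow_one_sub_le {q r : ℝ} (hq : 1 ≤ q) (hr : 0 < r) (hr1 : r ≤ 1) :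
    (1 - r / (4 * q)) ^ (1 - q) ≤ 1 + r / 2 := by
  have hx : r / (4 * q) ≤ 1 / 4 := by
    rw [div_le_div_iff₀ (by linarith) (by norm_num)]; nlinarith
  have hx0 : 0 < r / (4 * q) := by positivity
  have h1 : 1 - r / 4 ≤ (1 - r / (4 * q)) ^ q := by
    have := one_add_mul_self_le_rpow_one_add (s := -(r / (4 * q))) (by linarith) hq
    have e : q * -(r / (4 * q)) = - (r / 4) := by field_simp
    rw [e] at this
    simpa [sub_eq_add_neg] using this
  have h2 : (1 - r / (4 * q)) ^ q ≤ (1 - r / (4 * q)) ^ (q - 1) :=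
    Real.rpow_le_rpow_of_exponent_ge (by linarith) (by linarith) (by linarith)
  rw [show (1 - q) = -(q - 1) by ring, Real.rpow_neg (by linarith)]
  refine (inv_anti₀ (by linarith) (h1.trans h2)).trans ?_
  rw [inv_le_iff_one_le_mul₀ (by linarith)]
  nlinarith

namespace DCube

variable {d : ℕ} {bad : DCube d → DCube d → Prop}

lemma lintegral_rpow_add_stopFun_le {q : ℝ} (hq : 1 ≤ q) {w₁ w₂ θ D : ℝ≥0∞} (hw : w₁ + w₂ = 1)
    (h₁ : w₁ ≠ 0) (h₂ : w₂ ≠ 0) (hθ : w₁ ^ (1 - q) ≤ θ) {c : DCube d → ℝ≥0∞}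
    {φ : DCube d → (Fin d → ℝ) → ℝ≥0∞} (hφ : ∀ L, Measurable (φ L))
    (hD : ∀ m L, ∫⁻ x in L.set, θ ^ stopCount bad m L L x * φ L x ^ q ≤ D * L.evol)
    (m : ℕ) (Q K : DCube d) {s : (Fin d → ℝ) → ℝ≥0∞} (hs : Measurable s) :
    ∫⁻ x in K.set, (s x + stopFun bad (fun L x => c L * φ L x) m Q K x) ^ q ≤
      (∫⁻ x in K.set, θ ^ stopCount bad m Q K x * s x ^ q) +
        w₂ ^ (1 - q) * (D * stopSum bad (fun L => c L ^ q * L.evol) m Q K) := by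
  classical
  induction m generalizing Q K s with
  | zero => simp [stopCount, stopFun, stopSum]
  | succ m ih =>
    simp only [stopFun, stopCount, stopSum]
    rw [setLIntegral_kid K fun L x => (s x + ((if bad L Q then c L * φ L x else 0) +
      stopFun bad _ m (principal bad Q L) L x)) ^ q,
      setLIntegral_kid K fun L x => θ ^ ((if bad L Q then 1 else 0) +
      stopCount bad m (principal bad Q L) L x) * s x ^ q,
      Finset.mul_sum, Finset.mul_sum, ← Finset.sum_add_distrib]
    refine Finset.sum_le_sum fun t _ => ?_
    by_cases hb : bad (K.child t) Q
    · simp only [hb, if_true, principal, ← add_assoc]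
      set L := K.child t
      have hpow : Measurable fun x => θ ^ stopCount bad m L L x := by
        exact (measurable_from_nat (f := fun k => θ ^ k)).comp (measurable_stopCount m L L)
      refine (ih L L (hs.add ((hφ L).const_mul (c L)))).trans ?_
      have : ∫⁻ x in L.set, θ ^ stopCount bad m L L x * (s x + c L * φ L x) ^ q ≤
          (∫⁻ x in L.set, θ ^ (1 + stopCount bad m L L x) * s x ^ q) +
            w₂ ^ (1 - q) * (D * (c L ^ q * L.evol)) := by
        calc _ ≤ ∫⁻ x in L.set, (θ ^ (1 + stopCount bad m L L x) * s x ^ q +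
                (w₂ ^ (1 - q) * c L ^ q) * (θ ^ stopCount bad m L L x * φ L x ^ q)) := by
              refine lintegral_mono fun x => ?_
              calc _ ≤ θ ^ stopCount bad m L L x * (w₁ ^ (1 - q) * s x ^ q +
                    w₂ ^ (1 - q) * (c L * φ L x) ^ q) := by
                    gcongr
                    exact ENNReal.add_rpow_le_weighted hq hw h₁ h₂ _ _
                _ ≤ θ ^ stopCount bad m L L x * (θ * s x ^ q +
                    w₂ ^ (1 - q) * (c L * φ L x) ^ q) := by gcongr
                _ = _ := by
                    rw [ENNReal.mul_rpow_of_nonneg _ _ (by linarith)]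
                    ring
          _ = (∫⁻ x in L.set, θ ^ (1 + stopCount bad m L L x) * s x ^ q) +
                (w₂ ^ (1 - q) * c L ^ q) *
                  ∫⁻ x in L.set, θ ^ stopCount bad m L L x * φ L x ^ q := by
              rw [lintegral_add_right, lintegral_const_mul]
              · exact hpow.mul ((hφ L).pow_const q)
              · exact (hpow.mul ((hφ L).pow_const q)).const_mul _
          _ ≤ (∫⁻ x in L.set, θ ^ (1 + stopCount bad m L L x) * s x ^ q) +
                (w₂ ^ (1 - q) * c L ^ q) * (D * L.evol) := by gcongr; exact hD m L
          _ = _ := by ring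
      calc _ ≤ _ := add_le_add_left this _
        _ = _ := by ring
    · simp only [hb, if_false, principal, zero_add]
      exact ih _ _ hs

lemma lintegral_sparse_rpow_le {q r : ℝ} (hq : 1 ≤ q) (hr : 0 < r) (hr1 : r ≤ 1) {C : ℝ≥0∞}
    {c : DCube d → ℝ≥0∞} {φ : DCube d → (Fin d → ℝ) → ℝ≥0∞} (hφ : ∀ L, Measurable (φ L))
    (hw : ∀ (L K : DCube d) (E : Set (Fin d → ℝ)), MeasurableSet E → E ⊆ K.set →
      2 * volume E ≤ K.evol →
        (1 + ENNReal.ofReal r) * ∫⁻ x in E, φ L x ^ q ≤ ∫⁻ x in K.set, φ L x ^ q)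
    (hS : ∀ m (Q : DCube d), 2 * volume (badSet bad m Q Q) ≤ Q.evol)
    (hC : ∀ L, ∫⁻ x in L.set, φ L x ^ q ≤ C * L.evol) (m : ℕ) (T : DCube d) :
    ∫⁻ x in T.set, (c T * φ T x + stopFun bad (fun L x => c L * φ L x) m T T x) ^ q ≤
      ENNReal.ofReal ((4 * q / r) ^ (q - 1)) * (2 * C) *
        (c T ^ q * T.evol + stopSum bad (fun L => c L ^ q * L.evol) m T T) := by
  have hx : r / (4 * q) ≤ 1 / 4 := by
    rw [div_le_div_iff₀ (by linarith) (by norm_num)]; nlinarith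
  have hx0 : 0 < r / (4 * q) := by positivity
  have hD : ∀ m (L : DCube d), ∫⁻ x in L.set, ENNReal.ofReal (1 + r / 2) ^ stopCount bad m L L x *
      φ L x ^ q ≤ 2 * C * L.evol := by
    intro m L
    refine (lintegral_pow_stopCount_le (hw L) hS ?_ ofReal_ne_top m L L).trans ?_
    · rw [← ENNReal.ofReal_ofNat 2, ← ENNReal.ofReal_mul (by positivity),
        ← ENNReal.ofReal_add (by norm_num) hr.le]
      congr 1; ring
    · calc _ ≤ (∫⁻ x in L.set, φ L x ^ q) + ∫⁻ x in L.set, φ L x ^ q := by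
            gcongr
            exact hw L L _ (measurableSet_badSet _ _ _) (badSet_subset _ _ _) (hS _ _)
        _ ≤ C * L.evol + C * L.evol := add_le_add (hC L) (hC L)
        _ = _ := by ring
  have e2 : ENNReal.ofReal (r / (4 * q)) ^ (1 - q) = ENNReal.ofReal ((4 * q / r) ^ (q - 1)) := by
    rw [ENNReal.ofReal_rpow_of_pos hx0, show 1 - q = -(q - 1) by ring,
      Real.rpow_neg hx0.le, ← Real.inv_rpow hx0.le, inv_div]
  refine (lintegral_rpow_add_stopFun_le hq (w₁ := ENNReal.ofReal (1 - r / (4 * q)))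
    (w₂ := ENNReal.ofReal (r / (4 * q))) (θ := ENNReal.ofReal (1 + r / 2)) (D := 2 * C) ?_ ?_ ?_ ?_
    hφ hD m T T ((hφ T).const_mul (c T))).trans ?_
  · rw [← ENNReal.ofReal_add (by linarith) hx0.le]; simp
  · simp only [ne_eq, ofReal_eq_zero, not_le]; linarith
  · simpa using hx0
  · rw [ENNReal.ofReal_rpow_of_pos (by linarith)]
    exact ENNReal.ofReal_le_ofReal (Real.one_sub_rpow_one_sub_le hq hr hr1)
  · rw [e2, mul_add, mul_assoc _ (2 * C)  (stopSum _ _ _ _ _)]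
    gcongr
    have h1 : (1 : ℝ≥0∞) ≤ ENNReal.ofReal ((4 * q / r) ^ (q - 1)) := by
      rw [ENNReal.one_le_ofReal]
      refine Real.one_le_rpow ?_ (by linarith)
      rw [le_div_iff₀ hr]; linarith
    calc ∫⁻ x in T.set, ENNReal.ofReal (1 + r / 2) ^ stopCount bad m T T x * (c T * φ T x) ^ q
        = c T ^ q * ∫⁻ x in T.set, ENNReal.ofReal (1 + r / 2) ^ stopCount bad m T T x *
            φ T x ^ q := by
          rw [← lintegral_const_mul]
          · simp_rw [ENNReal.mul_rpow_of_nonneg _ _ (show 0 ≤ q by linarith)]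
            congr 1; ext x; ring
          · exact ((measurable_from_nat (f := fun k => ENNReal.ofReal (1 + r / 2) ^ k)).comp
              (measurable_stopCount m T T)).mul ((hφ T).pow_const q)
      _ ≤ c T ^ q * (2 * C * T.evol) := by gcongr; exact hD m T
      _ = 1 * (2 * C * (c T ^ q * T.evol)) := by ring
      _ ≤ ENNReal.ofReal ((4 * q / r) ^ (q - 1)) * (2 * C * (c T ^ q * T.evol)) := by gcongr
      _ = _ := by ring
end DCube

lemma ENNReal.le_rpow_of_le_mul_rpow {p : ℝ} (hp : 1 < p) {X B : ℝ≥0∞} (hX : X ≠ ⊤)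
    (h : X ≤ B * X ^ (1 - 1 / p)) : X ≤ B ^ p := by
  rcases eq_or_ne X 0 with rfl | h0
  · exact bot_le
  have hp0 : 0 < p := by linarith
  have e : X = X ^ (1 / p) * X ^ (1 - 1 / p) := by
    rw [← ENNReal.rpow_add _ _ h0 hX]; simp
  have h1 : X ^ (1 / p) ≤ B := by
    rw [e] at h
    have hz : X ^ (1 - 1 / p) ≠ 0 := by simp [h0, hX]
    have ht : X ^ (1 - 1 / p) ≠ ⊤ := by simp [h0, hX]
    have h' : X ^ (1 / p) * X ^ (1 - 1 / p) ≤ B * X ^ (1 - 1 / p) := by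
      rw [← e] at h; rwa [← e]
    exact (ENNReal.mul_le_mul_iff_left hz ht).1 h'
  calc X = (X ^ (1 / p)) ^ p := by rw [← ENNReal.rpow_mul]; simp [hp0.ne']
    _ ≤ B ^ p := by gcongr

namespace DCube

variable {d : ℕ} {bad : DCube d → DCube d → Prop}

lemma stopSum_ne_top {t : DCube d → ℝ≥0∞} (ht : ∀ L, t L ≠ ⊤) (m : ℕ) (Q K : DCube d) :
    stopSum bad t m Q K ≠ ⊤ := by
  classical
  induction m generalizing Q K with
  | zero => simp [stopSum]
  | succ m ih =>
    simp only [stopSum]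
    refine ENNReal.sum_ne_top.2 fun s _ => ENNReal.add_ne_top.2 ⟨?_, ih _ _⟩
    split_ifs
    · exact ht _
    · simp

/-- The average of a nonnegative function over a cube. -/
def lavg (K : DCube d) (F : (Fin d → ℝ) → ℝ≥0∞) : ℝ≥0∞ := K.evol⁻¹ * ∫⁻ x in K.set, F x

lemma lavg_mul_evol (K : DCube d) (F : (Fin d → ℝ) → ℝ≥0∞) :
    K.lavg F * K.evol = ∫⁻ x in K.set, F x := by
  rw [lavg, mul_comm, ← mul_assoc, ENNReal.mul_inv_cancel K.evol_ne_zero K.evol_ne_top, one_mul]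

lemma lintegral_sparse_mul {c : DCube d → ℝ≥0∞}
    {φ : DCube d → (Fin d → ℝ) → ℝ≥0∞} (hφ : ∀ L, Measurable (φ L))
    {ψ : (Fin d → ℝ) → ℝ≥0∞} (hψ : Measurable ψ) (m : ℕ) (T : DCube d) :
    ∫⁻ x in T.set, (c T * φ T x + stopFun bad (fun L x => c L * φ L x) m T T x) * ψ x =
      c T * T.lavg (fun x => φ T x * ψ x) * T.evol +
        stopSum bad (fun L => c L * L.lavg (fun x => φ L x * ψ x) * L.evol) m T T := by
  simp only [add_mul]
  rw [lintegral_add_left (f := fun x => c T * φ T x * ψ x) (((hφ T).const_mul _).mul hψ),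
    setLIntegral_stopFun_mul (fun L => (hφ L).const_mul _) hψ]
  simp only [mul_assoc, lavg_mul_evol]
  have : ∀ L : DCube d, ∫⁻ x in L.set, c L * (φ L x * ψ x) =
      c L * ∫⁻ x in L.set, φ L x * ψ x := fun L => lintegral_const_mul _ ((hφ L).mul hψ)
  simp only [this]

lemma carleson_stopSum {p : ℝ} (hp : 1 < p) 
    (hS : ∀ m (Q : DCube d), 2 * volume (badSet bad m Q Q) ≤ Q.evol)
    {F : (Fin d → ℝ) → ℝ≥0∞} (hF : Measurable F) (hFt : ∀ L : DCube d, L.lavg F ≠ ⊤)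
    (m : ℕ) (T : DCube d) :
    T.lavg F ^ p * T.evol + stopSum bad (fun L => L.lavg F ^ p * L.evol) m T T ≤
      (ENNReal.ofReal ((4 * (p / (p - 1)) / 1) ^ (p / (p - 1) - 1)) * (2 * 1)) ^ (p - 1) *
        ∫⁻ x in T.set, F x ^ p := by
  set q := p / (p - 1) with hq
  have hp1 : 0 < p - 1 := by linarith
  have hpq : q.HolderConjugate p := (Real.HolderConjugate.conjExponent hp).symm
  have hq1 : 1 < q := hpq.lt
  set C := ENNReal.ofReal ((4 * q / 1) ^ (q - 1)) * (2 * 1)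
  set Y := T.lavg F ^ p * T.evol + stopSum bad (fun L => L.lavg F ^ p * L.evol) m T T with hY
  have hpow : ∀ L : DCube d, L.lavg F ^ (p - 1) * L.lavg F = L.lavg F ^ p := by
    intro L
    rcases eq_or_ne (L.lavg F) 0 with h0 | h0
    · rw [h0, ENNReal.zero_rpow_of_pos (by linarith : 0 < p)]; simp
    · conv_rhs => rw [← sub_add_cancel p 1, ENNReal.rpow_add _ _ h0 (hFt L), ENNReal.rpow_one]
  have hYt : Y ≠ ⊤ := by
    have h : ∀ L : DCube d, L.lavg F ^ p * L.evol ≠ ⊤ := fun L =>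
      ENNReal.mul_ne_top (ENNReal.rpow_ne_top_of_nonneg (by linarith) (hFt L)) L.evol_ne_top
    exact ENNReal.add_ne_top.2 ⟨h T, stopSum_ne_top h _ _ _⟩
  set S : (Fin d → ℝ) → ℝ≥0∞ := fun x => T.lavg F ^ (p - 1) * 1 +
    stopFun bad (fun L _ => L.lavg F ^ (p - 1) * 1) m T T x with hSdef
  have hSm : Measurable S :=
    measurable_const.add (measurable_stopFun (fun _ => measurable_const) _ _ _)
  have h1 : ∫⁻ x in T.set, S x * F x = Y := by
    have := lintegral_sparse_mul (bad := bad) (c := fun L => L.lavg F ^ (p - 1))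
      (φ := fun _ _ => 1) (fun _ => measurable_const) hF m T
    simp only [one_mul, hpow] at this
    exact this
  have h2 : ∫⁻ x in T.set, S x ^ q ≤ C * Y := by
    have := lintegral_sparse_rpow_le (bad := bad) (q := q) (r := 1) hq1.le one_pos le_rfl (C := 1)
      (c := fun L => L.lavg F ^ (p - 1)) (φ := fun _ _ => 1) (fun _ => measurable_const)
      ?_ hS ?_ m T
    · refine this.trans (le_of_eq ?_)
      have e : ∀ L : DCube d, (L.lavg F ^ (p - 1)) ^ q = L.lavg F ^ p := fun L => by
        rw [← ENNReal.rpow_mul]; congr 1; rw [hq]; field_simp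
      simp only [e]
      rfl
    · intro _ K E _ _ hE
      simpa [one_add_one_eq_two, volume_set] using hE
    · intro L; simp [volume_set]
  have h3 : Y ≤ (C * Y) ^ (1 / q) * (∫⁻ x in T.set, F x ^ p) ^ (1 / p) := by
    calc Y = ∫⁻ x in T.set, (S * F) x := h1.symm
      _ ≤ (∫⁻ x in T.set, S x ^ q) ^ (1 / q) * (∫⁻ x in T.set, F x ^ p) ^ (1 / p) :=
          ENNReal.lintegral_mul_le_Lp_mul_Lq _ hpq hSm.aemeasurable hF.aemeasurable
      _ ≤ _ := by gcongr
  have hqe : 1 / q = 1 - 1 / p := by rw [hq]; field_simp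
  have h4 := ENNReal.le_rpow_of_le_mul_rpow hp (B := C ^ (1 / q) *
    (∫⁻ x in T.set, F x ^ p) ^ (1 / p)) hYt (by
      rw [ENNReal.mul_rpow_of_nonneg _ _ (by positivity)] at h3
      rw [← hqe]
      calc Y ≤ _ := h3
        _ = _ := by ring)
  rw [ENNReal.mul_rpow_of_nonneg _ _ (by linarith), ← ENNReal.rpow_mul, ← ENNReal.rpow_mul] at h4
  convert h4 using 2
  · congr 1; rw [hqe]; field_simp
  · rw [one_div, inv_mul_cancel₀ (by linarith), ENNReal.rpow_one]
end DCube

section LinearAlgebra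

variable {n : ℕ}

lemma matNorm_nonneg (M : Matrix (Fin n) (Fin n) ℂ) : 0 ≤ matNorm M := norm_nonneg _

lemma norm_mApp_le (M : Matrix (Fin n) (Fin n) ℂ) (v : EuclideanSpace ℂ (Fin n)) :
    ‖mApp M v‖ ≤ matNorm M * ‖v‖ := ContinuousLinearMap.le_opNorm _ _

lemma mApp_mul (M N : Matrix (Fin n) (Fin n) ℂ) (v : EuclideanSpace ℂ (Fin n)) :
    mApp (M * N) v = mApp M (mApp N v) := by simp [mApp, map_mul]

lemma matNorm_mul_le (M N : Matrix (Fin n) (Fin n) ℂ) :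
    matNorm (M * N) ≤ matNorm M * matNorm N := by
  simpa [matNorm, map_mul] using norm_mul_le _ _

lemma mApp_one (v : EuclideanSpace ℂ (Fin n)) : mApp 1 v = v := by simp [mApp, map_one]

lemma mApp_sub (M : Matrix (Fin n) (Fin n) ℂ) (u v : EuclideanSpace ℂ (Fin n)) :
    mApp M (u - v) = mApp M u - mApp M v := map_sub _ _ _

lemma mApp_zero (M : Matrix (Fin n) (Fin n) ℂ) : mApp M 0 = 0 := map_zero _

lemma mApp_smul (M : Matrix (Fin n) (Fin n) ℂ) (c : ℝ) (u : EuclideanSpace ℂ (Fin n)) :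
    mApp M (c • u) = c • mApp M u := LinearMap.map_smul_of_tower
    (Matrix.toEuclideanCLM (𝕜 := ℂ) (n := Fin n) M).toLinearMap c u

lemma inner_mApp_left (M : Matrix (Fin n) (Fin n) ℂ) (u v : EuclideanSpace ℂ (Fin n)) :
    inner ℂ (mApp M u) v = inner ℂ u (mApp M.conjTranspose v) := by
  have : Matrix.toEuclideanCLM (𝕜 := ℂ) (n := Fin n) M.conjTranspose =
      ContinuousLinearMap.adjoint (Matrix.toEuclideanCLM (𝕜 := ℂ) (n := Fin n) M) := by
    rw [← ContinuousLinearMap.star_eq_adjoint, ← map_star]; rfl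
  rw [mApp, mApp, this, ContinuousLinearMap.adjoint_inner_right]

lemma matNorm_le_sum (M : Matrix (Fin n) (Fin n) ℂ) :
    matNorm M ≤ ∑ i, ‖mApp M (EuclideanSpace.single i 1)‖ := by
  refine ContinuousLinearMap.opNorm_le_bound _ (by positivity) fun v => ?_
  have hv : v = ∑ i, v i • EuclideanSpace.single i (1 : ℂ) := by
    ext j
    simp [Finset.sum_apply, Pi.single_apply]
  calc ‖Matrix.toEuclideanCLM (𝕜 := ℂ) (n := Fin n) M v‖
      = ‖∑ i, v i • mApp M (EuclideanSpace.single i (1 : ℂ))‖ := by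
        conv_lhs => rw [hv]
        simp [mApp, map_sum, map_smul]
    _ ≤ ∑ i, ‖v i • mApp M (EuclideanSpace.single i (1 : ℂ))‖ := norm_sum_le _ _
    _ ≤ ∑ i, ‖mApp M (EuclideanSpace.single i (1 : ℂ))‖ * ‖v‖ := by
        refine Finset.sum_le_sum fun i _ => ?_
        rw [norm_smul, mul_comm]
        gcongr
        exact PiLp.norm_apply_le v i
    _ = _ := by rw [Finset.sum_mul]

lemma ofReal_matNorm_rpow_le_sum {p : ℝ} (hp : 1 ≤ p) (M : Matrix (Fin n) (Fin n) ℂ) :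
    ENNReal.ofReal (matNorm M) ^ p ≤ (n : ℝ≥0∞) ^ (p - 1) *
      ∑ i, ENNReal.ofReal ‖mApp M (EuclideanSpace.single i 1)‖ ^ p := by
  calc ENNReal.ofReal (matNorm M) ^ p
      ≤ (∑ i, ENNReal.ofReal ‖mApp M (EuclideanSpace.single i 1)‖) ^ p := by
        gcongr
        rw [← ENNReal.ofReal_sum_of_nonneg (fun _ _ => norm_nonneg _)]
        exact ENNReal.ofReal_le_ofReal (matNorm_le_sum M)
    _ ≤ _ := by
        simpa using ENNReal.rpow_sum_le_const_mul_sum_rpow Finset.univ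
          (fun i => ENNReal.ofReal ‖mApp M (EuclideanSpace.single i 1)‖) hp

lemma mApp_apply (M : Matrix (Fin n) (Fin n) ℂ) (v : EuclideanSpace ℂ (Fin n)) (i : Fin n) :
    mApp M v i = ∑ j, M i j * v j := by
  simp [mApp, Matrix.mulVec, dotProduct]

lemma matNorm_pos (hn : 0 < n) {M : Matrix (Fin n) (Fin n) ℂ} (hM : M.PosDef) :
    0 < matNorm M := by
  refine lt_of_le_of_ne (matNorm_nonneg M) fun h => ?_
  have h0 : Matrix.toEuclideanCLM (𝕜 := ℂ) (n := Fin n) M = 0 := norm_eq_zero.1 h.symm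
  have h1 : M = 0 := by simpa using h0
  have hd := hM.det_pos
  have : Nonempty (Fin n) := ⟨⟨0, hn⟩⟩
  rw [h1, Matrix.det_zero] at hd
  exact lt_irrefl _ hd

end LinearAlgebra

section Measurability

variable {d n : ℕ} {W M N : (Fin d → ℝ) → Matrix (Fin n) (Fin n) ℂ}

lemma MatMeasurable.measurable (hM : MatMeasurable M) :
    Measurable fun x => (fun i j => M x i j : Fin n → Fin n → ℂ) :=
  measurable_pi_iff.2 fun i => measurable_pi_iff.2 fun j => hM i j

lemma MatMeasurable.comp_continuous {β : Type*} [TopologicalSpace β] [MeasurableSpace β]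
    [BorelSpace β] (hM : MatMeasurable M)
    {g : (Fin n → Fin n → ℂ) → β} (hg : Continuous g) : Measurable fun x => g (M x) :=
  hg.measurable.comp hM.measurable

lemma MatMeasurable.mul (hM : MatMeasurable M) (hN : MatMeasurable N) :
    MatMeasurable fun x => M x * N x := fun i j => by
  simp only [Matrix.mul_apply]
  exact Finset.measurable_sum _ fun k _ => (hM i k).mul (hN k j)

lemma matMeasurable_const (A : Matrix (Fin n) (Fin n) ℂ) :
    MatMeasurable fun _ : Fin d → ℝ => A := fun _ _ => measurable_const

lemma MatMeasurable.inv (hM : MatMeasurable M) : MatMeasurable fun x => (M x)⁻¹ := fun i j => by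
  have h1 : Measurable fun x => (M x).det :=
    hM.comp_continuous (g := fun A => Matrix.det A) (Continuous.matrix_det continuous_id)
  have h2 : Measurable fun x => (M x).adjugate i j :=
    hM.comp_continuous (g := fun A => Matrix.adjugate A i j)
      ((continuous_apply_apply i j).comp (Continuous.matrix_adjugate continuous_id))
  simp only [Matrix.inv_def, Ring.inverse_eq_inv', Matrix.smul_apply, smul_eq_mul]
  exact h1.inv.mul h2

lemma MatMeasurable.matNorm (hM : MatMeasurable M) : Measurable fun x => matNorm (M x) := by
  refine hM.comp_continuous (g := fun A => _root_.matNorm (A : Matrix (Fin n) (Fin n) ℂ)) ?_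
  exact continuous_norm.comp (LinearMap.continuous_of_finiteDimensional
    ((Matrix.toEuclideanCLM (𝕜 := ℂ) (n := Fin n)).toAlgEquiv.toLinearMap))

lemma MatMeasurable.mApp (hM : MatMeasurable M) {u : (Fin d → ℝ) → EuclideanSpace ℂ (Fin n)}
    (hu : Measurable u) : Measurable fun x => mApp (M x) (u x) := by
  have : Measurable fun x => WithLp.ofLp (_root_.mApp (M x) (u x)) := by
    refine measurable_pi_iff.2 fun i => ?_
    simp only [mApp_apply]
    refine Finset.measurable_sum _ fun j _ => (hM i j).mul ?_
    exact (measurable_pi_apply j).comp ((WithLp.measurable_ofLp 2 _).comp hu)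
  exact (WithLp.measurable_toLp 2 _).comp this

end Measurability

lemma Matrix.PosDef.mul_inv_self {n : ℕ} {M : Matrix (Fin n) (Fin n) ℂ} (hM : M.PosDef) :
    M * M⁻¹ = 1 :=
  Matrix.mul_nonsing_inv _ ((Matrix.isUnit_iff_isUnit_det _).1 hM.isUnit)

lemma Matrix.PosDef.inv_mul_self {n : ℕ} {M : Matrix (Fin n) (Fin n) ℂ} (hM : M.PosDef) :
    M⁻¹ * M = 1 :=
  Matrix.nonsing_inv_mul _ ((Matrix.isUnit_iff_isUnit_det _).1 hM.isUnit)

namespace DCube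

variable {d n : ℕ} {p c₁ c₂ : ℝ} {W : (Fin d → ℝ) → Matrix (Fin n) (Fin n) ℂ}
  {V : DCube d → Matrix (Fin n) (Fin n) ℂ}

lemma lintegral_matNorm_rpow_le_apNorm (hp : 1 < p) (K : DCube d) :
    ∫⁻ x in K.set, (∫⁻ t in K.set,
      ENNReal.ofReal (matNorm (W x * (W t)⁻¹)) ^ (p / (p - 1))) ^ (p - 1) ≤
      apNorm p W * K.evol ^ p := by
  have h1 : K.evol⁻¹ * ∫⁻ x in K.set, (K.evol⁻¹ * ∫⁻ t in K.set,
      ENNReal.ofReal (matNorm (W x * (W t)⁻¹)) ^ (p / (p - 1))) ^ (p - 1) ≤ apNorm p W := by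
    refine le_trans ?_ (le_iSup_of_le K.corner (le_iSup_of_le K.side
      (le_iSup_of_le (by unfold side; positivity) le_rfl)))
    change K.evol⁻¹ * _ ≤ K.evol⁻¹ * _
    have hsub := K.set_subset_cubeSet
    refine mul_le_mul_right ((lintegral_mono_set hsub).trans (lintegral_mono fun x => ?_)) _
    have hp1 : 0 ≤ p - 1 := by linarith
    change (K.evol⁻¹ * _) ^ _ ≤ (K.evol⁻¹ * _) ^ _
    gcongr
  have hp1 : 0 ≤ p - 1 := by linarith
  have h0 := K.evol_ne_zero
  have ht := K.evol_ne_top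
  simp only [ENNReal.mul_rpow_of_nonneg _ _ hp1] at h1
  rw [lintegral_const_mul' _ _ (by simp [h0, ht]), ← mul_assoc] at h1
  have e : K.evol ^ p * (K.evol⁻¹ * K.evol⁻¹ ^ (p - 1)) = 1 := by
    rw [← ENNReal.rpow_neg_one, ← ENNReal.rpow_mul, ← ENNReal.rpow_add _ _ h0 ht,
      ← ENNReal.rpow_add _ _ h0 ht, ← ENNReal.rpow_zero]
    congr 1; ring
  calc _ = K.evol ^ p * (K.evol⁻¹ * K.evol⁻¹ ^ (p - 1)) * ∫⁻ x in K.set, (∫⁻ t in K.set,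
      ENNReal.ofReal (matNorm (W x * (W t)⁻¹)) ^ (p / (p - 1))) ^ (p - 1) := by rw [e, one_mul]
    _ ≤ K.evol ^ p * apNorm p W := by rw [mul_assoc]; gcongr
    _ = _ := mul_comm _ _

lemma volume_rpow_mul_lintegral_le (hp : 1 < p) (hWm : MatMeasurable W)
    (hW : ∀ᵐ x ∂(volume : Measure (Fin d → ℝ)), (W x).PosDef)
    (M : Matrix (Fin n) (Fin n) ℂ) (K : DCube d) {E : Set (Fin d → ℝ)} (hEK : E ⊆ K.set)
    (hK : ∫⁻ x in K.set, ENNReal.ofReal (matNorm (W x * M)) ^ p ≠ ⊤) :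
    volume E ^ p * ∫⁻ x in K.set, ENNReal.ofReal (matNorm (W x * M)) ^ p ≤
      K.evol ^ p * (apNorm p W * ∫⁻ x in E, ENNReal.ofReal (matNorm (W x * M)) ^ p) := by
  have hpq : (p / (p - 1)).HolderConjugate p := (Real.HolderConjugate.conjExponent hp).symm
  have hp1 : 0 < p - 1 := by linarith
  have hp0 : 0 < p := by linarith
  set w : (Fin d → ℝ) → ℝ≥0∞ := fun x => ENNReal.ofReal (matNorm (W x * M)) with hw
  have hwm : Measurable w := ENNReal.measurable_ofReal.comp (hWm.mul (matMeasurable_const M)).matNorm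
  have hNm : ∀ x, Measurable fun t => ENNReal.ofReal (matNorm (W x * (W t)⁻¹)) := fun x =>
    ENNReal.measurable_ofReal.comp ((matMeasurable_const (W x)).mul hWm.inv).matNorm
  have key : ∀ x, volume E ^ p * w x ^ p ≤ (∫⁻ t in K.set,
      ENNReal.ofReal (matNorm (W x * (W t)⁻¹)) ^ (p / (p - 1))) ^ (p - 1) *
        ∫⁻ t in E, w t ^ p := by
    intro x
    have h1 : volume E * w x ≤ (∫⁻ t in E,
      ENNReal.ofReal (matNorm (W x * (W t)⁻¹)) ^ (p / (p - 1))) ^ (1 / (p / (p - 1))) *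
        (∫⁻ t in E, w t ^ p) ^ (1 / p) := by
      calc volume E * w x = ∫⁻ t in E, w x := by simp [mul_comm]
        _ ≤ ∫⁻ t in E, ENNReal.ofReal (matNorm (W x * (W t)⁻¹)) * w t := by
            refine lintegral_mono_ae ?_
            filter_upwards [ae_restrict_of_ae hW] with t ht
            rw [← ENNReal.ofReal_mul (matNorm_nonneg _)]
            refine ENNReal.ofReal_le_ofReal ?_
            refine le_trans (le_of_eq ?_) (matNorm_mul_le _ _)
            rw [← mul_assoc, mul_assoc (W x), ht.inv_mul_self, mul_one]
        _ ≤ _ := ENNReal.lintegral_mul_le_Lp_mul_Lq _ hpq (hNm x).aemeasurable hwm.aemeasurable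
    calc volume E ^ p * w x ^ p = (volume E * w x) ^ p :=
          (ENNReal.mul_rpow_of_nonneg _ _ hp0.le).symm
      _ ≤ ((∫⁻ t in K.set,
          ENNReal.ofReal (matNorm (W x * (W t)⁻¹)) ^ (p / (p - 1))) ^ (1 / (p / (p - 1))) *
          (∫⁻ t in E, w t ^ p) ^ (1 / p)) ^ p := by
            refine ENNReal.rpow_le_rpow (h1.trans ?_) hp0.le
            have : 0 ≤ 1 / (p / (p - 1)) := by positivity
            gcongr
      _ = _ := by
          rw [ENNReal.mul_rpow_of_nonneg _ _ hp0.le, ← ENNReal.rpow_mul, ← ENNReal.rpow_mul]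
          congr 2
          · field_simp
          · rw [one_div, inv_mul_cancel₀ hp0.ne', ENNReal.rpow_one]
  have hEt : volume E ≠ ⊤ := ((measure_mono hEK).trans_lt
    (by rw [volume_set]; exact K.evol_ne_top.lt_top)).ne
  calc volume E ^ p * ∫⁻ x in K.set, w x ^ p = ∫⁻ x in K.set, volume E ^ p * w x ^ p :=
        (lintegral_const_mul' _ _ (ENNReal.rpow_ne_top_of_nonneg hp0.le hEt)).symm
    _ ≤ ∫⁻ x in K.set, (∫⁻ t in K.set,
      ENNReal.ofReal (matNorm (W x * (W t)⁻¹)) ^ (p / (p - 1))) ^ (p - 1) *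
        ∫⁻ t in E, w t ^ p := lintegral_mono key
    _ ≤ _ := by
      have hI : ∫⁻ t in E, w t ^ p ≠ ⊤ := ((lintegral_mono_set hEK).trans_lt hK.lt_top).ne
      rw [lintegral_mul_const' _ _ hI]
      calc _ ≤ apNorm p W * K.evol ^ p * ∫⁻ t in E, w t ^ p := by
              gcongr; exact lintegral_matNorm_rpow_le_apNorm hp K
          _ = _ := by ring
end DCube

namespace DCube

variable {d n : ℕ} {p c₁ c₂ : ℝ} {W : (Fin d → ℝ) → Matrix (Fin n) (Fin n) ℂ}
  {V : DCube d → Matrix (Fin n) (Fin n) ℂ}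

lemma redAvgD_rpow_mul_evol (hp : 0 < p) (K : DCube d) (e : EuclideanSpace ℂ (Fin n)) :
    redAvgD p W K e ^ p * K.evol = ∫⁻ x in K.set, ENNReal.ofReal ‖mApp (W x) e‖ ^ p := by
  rw [redAvgD, ← ENNReal.rpow_mul, one_div, inv_mul_cancel₀ hp.ne', ENNReal.rpow_one]
  exact lavg_mul_evol K _

lemma lintegral_mApp_rpow_le (hp : 0 < p) (hc₁ : 0 < c₁) (hV : IsReducing p c₁ c₂ W V)
    (K : DCube d) (e : EuclideanSpace ℂ (Fin n)) :
    ∫⁻ x in K.set, ENNReal.ofReal ‖mApp (W x) e‖ ^ p ≤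
      ((ENNReal.ofReal c₁)⁻¹ * ENNReal.ofReal ‖mApp (V K) e‖) ^ p * K.evol := by
  rw [← redAvgD_rpow_mul_evol hp]
  gcongr
  rw [← ENNReal.div_eq_inv_mul,
    ENNReal.le_div_iff_mul_le (by simp [hc₁]) (by simp), mul_comm]
  exact ((hV K).2 e).1

lemma norm_mApp_rpow_mul_evol_le (hp : 0 < p) (hV : IsReducing p c₁ c₂ W V)
    (K : DCube d) (e : EuclideanSpace ℂ (Fin n)) :
    ENNReal.ofReal ‖mApp (V K) e‖ ^ p * K.evol ≤
      ENNReal.ofReal c₂ ^ p * ∫⁻ x in K.set, ENNReal.ofReal ‖mApp (W x) e‖ ^ p := by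
  rw [← redAvgD_rpow_mul_evol hp, ← mul_assoc, ← ENNReal.mul_rpow_of_nonneg _ _ hp.le]
  gcongr
  exact ((hV K).2 e).2

lemma lintegral_matNorm_le_sum {q : ℝ} (hq : 1 ≤ q) {F : (Fin d → ℝ) → Matrix (Fin n) (Fin n) ℂ}
    (hF : MatMeasurable F) (K : DCube d) :
    ∫⁻ x in K.set, ENNReal.ofReal (matNorm (F x)) ^ q ≤ (n : ℝ≥0∞) ^ (q - 1) *
      ∑ i, ∫⁻ x in K.set, ENNReal.ofReal ‖mApp (F x) (EuclideanSpace.single i 1)‖ ^ q := by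
  have hm : ∀ i, Measurable fun x =>
      ENNReal.ofReal ‖mApp (F x) (EuclideanSpace.single i 1)‖ ^ q := fun i =>
    (ENNReal.measurable_ofReal.comp (hF.mApp measurable_const).norm).pow_const q
  calc _ ≤ ∫⁻ x in K.set, (n : ℝ≥0∞) ^ (q - 1) *
        ∑ i, ENNReal.ofReal ‖mApp (F x) (EuclideanSpace.single i 1)‖ ^ q :=
        lintegral_mono fun x => ofReal_matNorm_rpow_le_sum hq _
    _ = _ := by
      rw [lintegral_const_mul _ (Finset.measurable_sum _ fun i _ => hm i),
        lintegral_finsetSum _ fun i _ => hm i]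

lemma lintegral_matNorm_mul_ne_top (hp : 1 < p) (hc₁ : 0 < c₁) (hWm : MatMeasurable W)
    (hV : IsReducing p c₁ c₂ W V) (M : Matrix (Fin n) (Fin n) ℂ) (K : DCube d) :
    ∫⁻ x in K.set, ENNReal.ofReal (matNorm (W x * M)) ^ p ≠ ⊤ := by
  have hp0 : 0 < p := by linarith
  refine ((lintegral_matNorm_le_sum hp.le (hWm.mul (matMeasurable_const M)) K).trans_lt ?_).ne
  refine ENNReal.mul_lt_top (ENNReal.rpow_lt_top_of_nonneg (by linarith) (by simp)) ?_
  refine ENNReal.sum_lt_top.2 fun i _ => ?_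
  simp only [mApp_mul]
  refine (lintegral_mApp_rpow_le hp0 hc₁ hV K _).trans_lt (ENNReal.mul_lt_top ?_
    K.evol_ne_top.lt_top)
  exact ENNReal.rpow_lt_top_of_nonneg hp0.le (ENNReal.mul_ne_top (by simp [hc₁]) (by simp))

lemma lintegral_matNorm_mul_inv_le (hp : 1 < p) (hc₁ : 0 < c₁) (hWm : MatMeasurable W)
    (hV : IsReducing p c₁ c₂ W V) (K : DCube d) :
    ∫⁻ x in K.set, ENNReal.ofReal (matNorm (W x * (V K)⁻¹)) ^ p ≤
      ((n : ℝ≥0∞) ^ p * (ENNReal.ofReal c₁)⁻¹ ^ p) * K.evol := by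
  have hp0 : 0 < p := by linarith
  refine (lintegral_matNorm_le_sum hp.le (hWm.mul (matMeasurable_const _)) K).trans ?_
  rcases eq_or_ne n 0 with rfl | hn
  · simp
  calc _ ≤ (n : ℝ≥0∞) ^ (p - 1) * ∑ i : Fin n, (ENNReal.ofReal c₁)⁻¹ ^ p * K.evol := by
        gcongr with i
        simp only [mApp_mul]
        refine (lintegral_mApp_rpow_le hp0 hc₁ hV K _).trans (le_of_eq ?_)
        rw [← mApp_mul, (hV K).1.mul_inv_self, mApp_one]
        simp
    _ = _ := by
        rw [Finset.sum_const, Finset.card_univ, Fintype.card_fin, nsmul_eq_mul]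
        conv_rhs => rw [← sub_add_cancel p 1, ENNReal.rpow_add _ _ (by simpa) (by simp),
          ENNReal.rpow_one, sub_add_cancel]
        ring

lemma one_le_apNorm (hn : 0 < n) (hp : 1 < p) (hc₁ : 0 < c₁) (hWm : MatMeasurable W)
    (hW : ∀ᵐ x ∂(volume : Measure (Fin d → ℝ)), (W x).PosDef)
    (hV : IsReducing p c₁ c₂ W V) : 1 ≤ apNorm p W := by
  have hp0 : 0 < p := by linarith
  set K : DCube d := ⟨0, 0⟩
  have ht := lintegral_matNorm_mul_ne_top hp hc₁ hWm hV 1 K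
  have h := volume_rpow_mul_lintegral_le hp hWm hW 1 K subset_rfl ht
  have h0 : ∫⁻ x in K.set, ENNReal.ofReal (matNorm (W x * 1)) ^ p ≠ 0 := by
    have hm : Measurable fun x => ENNReal.ofReal (matNorm (W x * 1)) ^ p :=
      (ENNReal.measurable_ofReal.comp (hWm.mul (matMeasurable_const 1)).matNorm).pow_const p
    rw [Ne, lintegral_eq_zero_iff hm]
    intro h
    have hne : (ae (volume.restrict K.set)).NeBot := by
      rw [ae_neBot, Ne, Measure.restrict_eq_zero, volume_set]
      exact K.evol_ne_zero
    obtain ⟨x, hx, hx'⟩ := (h.and (ae_restrict_of_ae hW)).exists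
    have := matNorm_pos hn hx'
    simp only [mul_one, Pi.zero_apply, ENNReal.rpow_eq_zero_iff, ofReal_eq_zero] at hx
    rcases hx with hx | hx
    · linarith
    · simp at hx
  rw [volume_set] at h
  have h2 := (ENNReal.mul_le_mul_iff_right (by simp [K.evol_ne_zero, K.evol_ne_top, hp0])
    (by simp [K.evol_ne_zero, K.evol_ne_top, hp0])).1 h
  refine (ENNReal.mul_le_mul_iff_left h0 ht).1 ?_
  rwa [one_mul]

lemma lintegral_doubling (hn : 0 < n) (hp : 1 < p) (hc₁ : 0 < c₁) (hWm : MatMeasurable W)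
    (hW : ∀ᵐ x ∂(volume : Measure (Fin d → ℝ)), (W x).PosDef)
    (hA : apNorm p W < ⊤) (hV : IsReducing p c₁ c₂ W V) 
    (M : Matrix (Fin n) (Fin n) ℂ) (K : DCube d) {E : Set (Fin d → ℝ)} (hE : MeasurableSet E)
    (hEK : E ⊆ K.set) (hE2 : 2 * volume E ≤ K.evol) :
    (1 + ENNReal.ofReal (2 ^ p * (apNorm p W).toReal)⁻¹) *
      ∫⁻ x in E, ENNReal.ofReal (matNorm (W x * M)) ^ p ≤
      ∫⁻ x in K.set, ENNReal.ofReal (matNorm (W x * M)) ^ p := by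
  have hp0 : 0 < p := by linarith
  have h1 := one_le_apNorm hn hp hc₁ hWm hW hV
  set A := apNorm p W
  have ht := lintegral_matNorm_mul_ne_top hp hc₁ hWm hV M K
  have h := volume_rpow_mul_lintegral_le hp hWm hW M K (E := K.set \ E) Set.sdiff_subset ht
  set w : (Fin d → ℝ) → ℝ≥0∞ := fun x => ENNReal.ofReal (matNorm (W x * M)) ^ p
  have hsplit : ∫⁻ x in K.set, w x = (∫⁻ x in E, w x) + ∫⁻ x in K.set \ E, w x := by
    rw [← lintegral_inter_add_sdiff w K.set hE, Set.inter_eq_right.2 hEK]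
  have hvol : K.evol ≤ 2 * volume (K.set \ E) := by
    have hEt : volume E ≠ ⊤ := ((measure_mono hEK).trans_lt
      (by rw [volume_set]; exact K.evol_ne_top.lt_top)).ne
    have hs : K.evol = volume E + volume (K.set \ E) := by
      rw [← volume_set, ← measure_inter_add_sdiff K.set hE, Set.inter_eq_right.2 hEK]
    have : volume E + volume E ≤ volume E + volume (K.set \ E) := by
      rw [← two_mul, ← hs]; exact hE2
    have := (ENNReal.add_le_add_iff_left hEt).1 this
    calc K.evol = volume E + volume (K.set \ E) := hs
      _ ≤ volume (K.set \ E) + volume (K.set \ E) := by gcongr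
      _ = _ := (two_mul _).symm
  have h3 : ∫⁻ x in K.set, w x ≤ 2 ^ p * A * ∫⁻ x in K.set \ E, w x := by
    refine (ENNReal.mul_le_mul_iff_right (a := K.evol ^ p)
      (by simp [K.evol_ne_zero, K.evol_ne_top, hp0])
      (by simp [K.evol_ne_zero, K.evol_ne_top, hp0])).1 ?_
    calc _ ≤ (2 * volume (K.set \ E)) ^ p * ∫⁻ x in K.set, w x := by gcongr
      _ = 2 ^ p * (volume (K.set \ E) ^ p * ∫⁻ x in K.set, w x) := by
          rw [ENNReal.mul_rpow_of_nonneg _ _ hp0.le, mul_assoc]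
      _ ≤ 2 ^ p * (K.evol ^ p * (A * ∫⁻ x in K.set \ E, w x)) := by gcongr
      _ = _ := by ring
  have e : ENNReal.ofReal (2 ^ p * A.toReal)⁻¹ = (2 ^ p * A)⁻¹ := by
    have hAr : 0 < A.toReal := ENNReal.toReal_pos (by positivity) hA.ne
    rw [ENNReal.ofReal_inv_of_pos (by positivity), ENNReal.ofReal_mul (by positivity),
      ENNReal.ofReal_toReal hA.ne, ← ENNReal.ofReal_rpow_of_pos two_pos, ENNReal.ofReal_ofNat]
  have hz : (2 : ℝ≥0∞) ^ p * A ≠ 0 := by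
    have : A ≠ 0 := (one_pos.trans_le h1).ne'
    simp [this]
  have hzt : (2 : ℝ≥0∞) ^ p * A ≠ ⊤ := ENNReal.mul_ne_top (by simp) hA.ne
  rw [hsplit, add_mul, one_mul, e]
  gcongr
  calc (2 ^ p * A)⁻¹ * ∫⁻ x in E, w x ≤ (2 ^ p * A)⁻¹ * (2 ^ p * A * ∫⁻ x in K.set \ E, w x) := by
        gcongr
        exact (lintegral_mono_set hEK).trans h3
    _ = _ := by rw [← mul_assoc, ENNReal.inv_mul_cancel hz hzt, one_mul]
end DCube

lemma Real.rpow_sub_two_mul_self {a q : ℝ} (ha : 0 ≤ a) (hq : 1 < q) :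
    a ^ (q - 2) * a = a ^ (q - 1) := by
  rcases ha.eq_or_lt with rfl | ha
  · rw [Real.zero_rpow (by linarith : q - 1 ≠ 0), mul_zero]
  · conv_lhs => rw [← Real.rpow_one a, ← Real.rpow_mul ha.le, one_mul, ← Real.rpow_add ha]
    congr 1; ring

lemma Real.rpow_sub_one_mul_self {a q : ℝ} (ha : 0 ≤ a) (hq : 1 < q) :
    a ^ (q - 1) * a = a ^ q := by
  rcases ha.eq_or_lt with rfl | ha
  · rw [Real.zero_rpow (by linarith : q ≠ 0), mul_zero]
  · conv_lhs => rw [← Real.rpow_one a, ← Real.rpow_mul ha.le, one_mul, ← Real.rpow_add ha]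
    congr 1; ring

lemma norm_mApp_inv_le_of_posDef {n : ℕ} {A B : Matrix (Fin n) (Fin n) ℂ} (hA : A.PosDef)
    (hB : B.PosDef) (e : EuclideanSpace ℂ (Fin n)) :
    ‖mApp A⁻¹ e‖ * ‖mApp A⁻¹ e‖ ≤ ‖mApp B⁻¹ e‖ * ‖mApp B (mApp A⁻¹ (mApp A⁻¹ e))‖ := by
  set y := mApp A⁻¹ e
  have h1 : inner ℂ y y = inner ℂ (mApp B⁻¹ e) (mApp B (mApp A⁻¹ y)) := by
    conv_lhs => rw [show y = mApp A⁻¹ e from rfl, inner_mApp_left, hA.isHermitian.inv.eq]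
    rw [← mApp_one e, ← hB.mul_inv_self, mApp_mul, inner_mApp_left, hB.isHermitian.eq,
      ← mApp_mul B B⁻¹ e, hB.mul_inv_self, mApp_one]
  calc ‖y‖ * ‖y‖ = ‖inner ℂ y y‖ := by rw [inner_self_eq_norm_sq_to_K]; simp [pow_two]
    _ ≤ _ := by rw [h1]; exact norm_inner_le_norm _ _

namespace DCube

variable {d n : ℕ} {p c₁ c₂ : ℝ} {W : (Fin d → ℝ) → Matrix (Fin n) (Fin n) ℂ}
  {V : DCube d → Matrix (Fin n) (Fin n) ℂ}

lemma norm_mApp_inv_rpow_mul_evol_le (hp : 1 < p) (hc₁ : 0 < c₁) (hWm : MatMeasurable W)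
    (hW : ∀ᵐ x ∂(volume : Measure (Fin d → ℝ)), (W x).PosDef) (hV : IsReducing p c₁ c₂ W V)
    (K : DCube d) (e : EuclideanSpace ℂ (Fin n)) :
    ENNReal.ofReal ‖mApp (V K)⁻¹ e‖ ^ (p / (p - 1)) * K.evol ≤
      (ENNReal.ofReal c₁)⁻¹ ^ (p / (p - 1)) *
        ∫⁻ x in K.set, ENNReal.ofReal ‖mApp (W x)⁻¹ e‖ ^ (p / (p - 1)) := by
  have hpq : (p / (p - 1)).HolderConjugate p := (Real.HolderConjugate.conjExponent hp).symm
  have hp0 : 0 < p := by linarith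
  have hsum : 1 / (p / (p - 1)) + 1 / p = 1 := by field_simp; ring
  set q := p / (p - 1) with hq
  have hq0 : 0 < q := hpq.pos
  set y := mApp (V K)⁻¹ e with hy
  set J := ∫⁻ x in K.set, ENNReal.ofReal ‖mApp (W x)⁻¹ e‖ ^ q with hJ
  rcases eq_or_ne y 0 with h0 | h0
  · rw [h0]; simp [hq0]
  have hY0 : ENNReal.ofReal ‖y‖ ≠ 0 := by simpa using h0
  have h1 : ENNReal.ofReal ‖y‖ * ENNReal.ofReal ‖y‖ * K.evol ≤
      J ^ (1 / q) * ((ENNReal.ofReal c₁)⁻¹ * ENNReal.ofReal ‖y‖ * K.evol ^ (1 / p)) := by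
    calc _ = ∫⁻ x in K.set, ENNReal.ofReal ‖y‖ * ENNReal.ofReal ‖y‖ := by
          rw [lintegral_const, Measure.restrict_apply_univ, volume_set]
      _ ≤ ∫⁻ x in K.set, ENNReal.ofReal ‖mApp (W x)⁻¹ e‖ *
            ENNReal.ofReal ‖mApp (W x) (mApp (V K)⁻¹ y)‖ := by
          refine lintegral_mono_ae ?_
          filter_upwards [ae_restrict_of_ae hW] with x hx
          rw [← ENNReal.ofReal_mul (norm_nonneg _), ← ENNReal.ofReal_mul (norm_nonneg _)]
          exact ENNReal.ofReal_le_ofReal (norm_mApp_inv_le_of_posDef (hV K).1 hx e)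
      _ ≤ J ^ (1 / q) * (∫⁻ x in K.set,
            ENNReal.ofReal ‖mApp (W x) (mApp (V K)⁻¹ y)‖ ^ p) ^ (1 / p) :=
          ENNReal.lintegral_mul_le_Lp_mul_Lq _ hpq
            (ENNReal.measurable_ofReal.comp (hWm.inv.mApp measurable_const).norm).aemeasurable
            (ENNReal.measurable_ofReal.comp (hWm.mApp measurable_const).norm).aemeasurable
      _ ≤ J ^ (1 / q) * (((ENNReal.ofReal c₁)⁻¹ * ENNReal.ofReal ‖y‖) ^ p * K.evol) ^ (1 / p) := by
          gcongr
          refine (lintegral_mApp_rpow_le hp0 hc₁ hV K _).trans (le_of_eq ?_)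
          rw [← mApp_mul, (hV K).1.mul_inv_self, mApp_one]
      _ = _ := by
          rw [ENNReal.mul_rpow_of_nonneg _ _ (by positivity : 0 ≤ 1 / p), ← ENNReal.rpow_mul,
            mul_one_div_cancel hp0.ne', ENNReal.rpow_one]
  have h2 : ENNReal.ofReal ‖y‖ * K.evol ^ (1 / q) ≤ (ENNReal.ofReal c₁)⁻¹ * J ^ (1 / q) := by
    have hz : ENNReal.ofReal ‖y‖ * K.evol ^ (1 / p) ≠ 0 :=
      mul_ne_zero hY0 (by simp [K.evol_ne_zero, K.evol_ne_top])
    have ht : ENNReal.ofReal ‖y‖ * K.evol ^ (1 / p) ≠ ⊤ :=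
      ENNReal.mul_ne_top ofReal_ne_top (by simp [K.evol_ne_zero, K.evol_ne_top])
    refine (ENNReal.mul_le_mul_iff_left hz ht).1 ?_
    calc _ = ENNReal.ofReal ‖y‖ * ENNReal.ofReal ‖y‖ * (K.evol ^ (1 / q) * K.evol ^ (1 / p)) := by
          ring
      _ = ENNReal.ofReal ‖y‖ * ENNReal.ofReal ‖y‖ * K.evol := by
          rw [← ENNReal.rpow_add _ _ K.evol_ne_zero K.evol_ne_top, hsum, ENNReal.rpow_one]
      _ ≤ _ := h1
      _ = _ := by ring
  have h3 := ENNReal.rpow_le_rpow h2 hq0.le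
  rwa [ENNReal.mul_rpow_of_nonneg _ _ hq0.le, ENNReal.mul_rpow_of_nonneg _ _ hq0.le,
    ← ENNReal.rpow_mul, ← ENNReal.rpow_mul, one_div_mul_cancel hq0.ne', ENNReal.rpow_one,
    ENNReal.rpow_one] at h3

lemma lintegral_matNorm_inv_ne_top (hp : 1 < p) 
    (hW : ∀ᵐ x ∂(volume : Measure (Fin d → ℝ)), (W x).PosDef) (hA : apNorm p W < ⊤)
    (K : DCube d) :
    ∫⁻ t in K.set, ENNReal.ofReal (matNorm (W t)⁻¹) ^ (p / (p - 1)) ≠ ⊤ := by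
  intro htop
  have hq0 : 0 < p / (p - 1) := div_pos (by linarith) (by linarith)
  have h := lintegral_matNorm_rpow_le_apNorm (W := W) hp K
  have h1 : ∫⁻ x in K.set, (⊤ : ℝ≥0∞) ≤ apNorm p W * K.evol ^ p := by
    refine (lintegral_mono_ae ?_).trans h
    filter_upwards [ae_restrict_of_ae hW] with x hx
    have : ∫⁻ t in K.set, ENNReal.ofReal (matNorm (W t)⁻¹) ^ (p / (p - 1)) ≤
        ENNReal.ofReal (matNorm (W x)⁻¹) ^ (p / (p - 1)) *
        ∫⁻ t in K.set, ENNReal.ofReal (matNorm (W x * (W t)⁻¹)) ^ (p / (p - 1)) := by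
      rw [← lintegral_const_mul' _ _ (by simp [hq0.le])]
      refine lintegral_mono fun t => ?_
      rw [← ENNReal.mul_rpow_of_nonneg _ _ hq0.le, ← ENNReal.ofReal_mul (matNorm_nonneg _)]
      gcongr
      refine le_trans (le_of_eq ?_) (matNorm_mul_le _ _)
      rw [← mul_assoc, hx.inv_mul_self, one_mul]
    rw [htop, top_le_iff] at this
    have : ∫⁻ t in K.set, ENNReal.ofReal (matNorm (W x * (W t)⁻¹)) ^ (p / (p - 1)) = ⊤ := by
      by_contra hne
      exact ENNReal.mul_ne_top (by simp [hq0.le]) hne this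
    rw [this, ENNReal.top_rpow_of_pos (by linarith)]
  rw [lintegral_const, Measure.restrict_apply_univ, volume_set,
    ENNReal.top_mul K.evol_ne_zero, top_le_iff] at h1
  exact ENNReal.mul_ne_top hA.ne (by simp [K.evol_ne_zero, K.evol_ne_top]) h1

lemma lintegral_mApp_inv_rpow_le (hp : 1 < p) (hWm : MatMeasurable W)
    (hW : ∀ᵐ x ∂(volume : Measure (Fin d → ℝ)), (W x).PosDef) (hA : apNorm p W < ⊤)
    (hV : IsReducing p c₁ c₂ W V) (K : DCube d) (e : EuclideanSpace ℂ (Fin n)) :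
    ∫⁻ x in K.set, ENNReal.ofReal ‖mApp (W x)⁻¹ e‖ ^ (p / (p - 1)) ≤
      (ENNReal.ofReal c₂ ^ p * apNorm p W) ^ (1 / (p - 1)) *
        ENNReal.ofReal ‖mApp (V K)⁻¹ e‖ ^ (p / (p - 1)) * K.evol := by
  have hpq : (p / (p - 1)).HolderConjugate p := (Real.HolderConjugate.conjExponent hp).symm
  have hp0 : 0 < p := by linarith
  have hp1 : 0 < p - 1 := by linarith
  have hfin := lintegral_matNorm_inv_ne_top hp hW hA K
  have hqp : (p / (p - 1) - 1) * p = p / (p - 1) := by field_simp; ring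
  have hqq : 1 - 1 / (p / (p - 1)) = 1 / p := by field_simp; ring
  have hApw := lintegral_matNorm_rpow_le_apNorm (W := W) hp K
  set q := p / (p - 1) with hq
  have hq1 : 1 < q := hpq.lt
  have hq0 : 0 < q := by linarith
  set a : (Fin d → ℝ) → ℝ := fun t => ‖mApp (W t)⁻¹ e‖ with ha
  set h : (Fin d → ℝ) → EuclideanSpace ℂ (Fin n) := fun t =>
    a t ^ (q - 2) • mApp (W t)⁻¹ (mApp (W t)⁻¹ e) with hh
  have ham : Measurable a := (hWm.inv.mApp measurable_const).norm
  have hhm : Measurable h :=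
    (ham.pow_const _).smul (hWm.inv.mApp (hWm.inv.mApp measurable_const))
  have hab : ∀ t, a t ≤ matNorm (W t)⁻¹ * ‖e‖ := fun t => norm_mApp_le _ _
  have hhle : ∀ t, ‖h t‖ ≤ ‖e‖ ^ (q - 1) * matNorm (W t)⁻¹ ^ q := by
    intro t
    rw [hh, norm_smul, Real.norm_of_nonneg (Real.rpow_nonneg (norm_nonneg _) _)]
    calc a t ^ (q - 2) * ‖mApp (W t)⁻¹ (mApp (W t)⁻¹ e)‖
        ≤ a t ^ (q - 2) * (matNorm (W t)⁻¹ * a t) := by gcongr; exact norm_mApp_le _ _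
      _ = matNorm (W t)⁻¹ * a t ^ (q - 1) := by
          rw [← Real.rpow_sub_two_mul_self (norm_nonneg _) hq1]; ring
      _ ≤ matNorm (W t)⁻¹ * (matNorm (W t)⁻¹ * ‖e‖) ^ (q - 1) := by
          exact mul_le_mul_of_nonneg_left (Real.rpow_le_rpow (norm_nonneg _) (hab t)
            (by linarith)) (matNorm_nonneg _)
      _ = _ := by
          rw [Real.mul_rpow (matNorm_nonneg _) (norm_nonneg _),
            ← Real.rpow_sub_one_mul_self (matNorm_nonneg (W t)⁻¹) hq1]; ring
  have hbint : Integrable (fun t => matNorm (W t)⁻¹ ^ q) (volume.restrict K.set) := by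
    refine ⟨(hWm.inv.matNorm.pow_const q).aestronglyMeasurable, ?_⟩
    rw [hasFiniteIntegral_iff_ofReal (ae_of_all _ fun t => Real.rpow_nonneg (matNorm_nonneg _) _)]
    refine lt_of_le_of_lt (le_of_eq ?_) hfin.lt_top
    congr 1; ext t
    rw [ENNReal.ofReal_rpow_of_nonneg (matNorm_nonneg _) hq0.le]
  have hint : Integrable h (volume.restrict K.set) :=
    (hbint.const_mul _).mono' hhm.aestronglyMeasurable (ae_of_all _ hhle)
  set v := ∫ t in K.set, h t with hv
  set I := ∫⁻ x in K.set, ENNReal.ofReal (a x) ^ q with hI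
  have hIt : I ≠ ⊤ := by
    refine ne_top_of_le_ne_top (ENNReal.mul_ne_top hfin (b := ENNReal.ofReal ‖e‖ ^ q)
      (by simp [hq0.le])) ?_
    rw [← lintegral_mul_const' _ _ (by simp [hq0.le])]
    refine lintegral_mono fun t => ?_
    rw [← ENNReal.mul_rpow_of_nonneg _ _ hq0.le, ← ENNReal.ofReal_mul (matNorm_nonneg _)]
    gcongr
    exact hab t
  have hIv : I ≤ ENNReal.ofReal ‖mApp (V K)⁻¹ e‖ * ENNReal.ofReal ‖mApp (V K) v‖ := by
    have h1 : ∀ᵐ t ∂(volume.restrict K.set), RCLike.re (inner ℂ e (h t)) = a t ^ q := by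
      filter_upwards [ae_restrict_of_ae hW] with t ht
      have : inner ℂ e (mApp (W t)⁻¹ (mApp (W t)⁻¹ e)) =
          inner ℂ (mApp (W t)⁻¹ e) (mApp (W t)⁻¹ e) := by
        rw [inner_mApp_left, ht.isHermitian.inv.eq]
      rw [hh, inner_smul_right_eq_smul, this, RCLike.smul_re, inner_self_eq_norm_mul_norm,
        ← mul_assoc, Real.rpow_sub_two_mul_self (norm_nonneg _) hq1,
        Real.rpow_sub_one_mul_self (norm_nonneg _) hq1]
    have h2 : I = ENNReal.ofReal (RCLike.re (inner ℂ e v)) := by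
      rw [hv, ← integral_inner hint, ← integral_re (hint.const_inner e), integral_congr_ae h1,
        ofReal_integral_eq_lintegral_ofReal]
      · exact lintegral_congr fun t => by
          rw [ENNReal.ofReal_rpow_of_nonneg (norm_nonneg _) hq0.le]
      · exact (hint.const_inner e).re.congr h1
      · exact ae_of_all _ fun t => Real.rpow_nonneg (norm_nonneg _) _
    rw [h2, ← ENNReal.ofReal_mul (norm_nonneg _)]
    refine ENNReal.ofReal_le_ofReal ?_
    have : inner ℂ e v = inner ℂ (mApp (V K)⁻¹ e) (mApp (V K) v) := by
      rw [inner_mApp_left, (hV K).1.isHermitian.inv.eq, ← mApp_mul, (hV K).1.inv_mul_self,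
        mApp_one]
    rw [this]
    exact (RCLike.re_le_norm _).trans (norm_inner_le_norm _ _)
  have hWv : ∫⁻ x in K.set, ENNReal.ofReal ‖mApp (W x) v‖ ^ p ≤ apNorm p W * K.evol ^ p * I := by
    calc _ ≤ ∫⁻ x in K.set, (∫⁻ t in K.set,
          ENNReal.ofReal (matNorm (W x * (W t)⁻¹)) ^ q) ^ (p - 1) * I := by
          refine lintegral_mono fun x => ?_
          have h1 : ENNReal.ofReal ‖mApp (W x) v‖ ≤ (∫⁻ t in K.set,
              ENNReal.ofReal (matNorm (W x * (W t)⁻¹)) ^ q) ^ (1 / q) * I ^ (1 / p) := by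
            have e1 : mApp (W x) v = ∫ t in K.set, mApp (W x) (h t) :=
              ((Matrix.toEuclideanCLM (𝕜 := ℂ) (n := Fin n) (W x)).integral_comp_comm hint).symm
            rw [e1, ofReal_norm]
            calc _ ≤ ∫⁻ t in K.set, ‖mApp (W x) (h t)‖ₑ := enorm_integral_le_lintegral_enorm _
              _ ≤ ∫⁻ t in K.set, ENNReal.ofReal (matNorm (W x * (W t)⁻¹)) *
                    ENNReal.ofReal (a t) ^ (q - 1) := by
                  refine lintegral_mono fun t => ?_
                  rw [← ofReal_norm, ENNReal.ofReal_rpow_of_nonneg (norm_nonneg _) (by linarith),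
                    ← ENNReal.ofReal_mul (matNorm_nonneg _)]
                  refine ENNReal.ofReal_le_ofReal ?_
                  rw [hh, mApp_smul, norm_smul,
                    Real.norm_of_nonneg (Real.rpow_nonneg (norm_nonneg _) _), ← mApp_mul]
                  calc _ ≤ a t ^ (q - 2) * (matNorm (W x * (W t)⁻¹) * a t) := by
                        gcongr; exact norm_mApp_le _ _
                    _ = _ := by
                        rw [← Real.rpow_sub_two_mul_self (norm_nonneg _) hq1]; ring
              _ ≤ (∫⁻ t in K.set, ENNReal.ofReal (matNorm (W x * (W t)⁻¹)) ^ q) ^ (1 / q) *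
                    (∫⁻ t in K.set, (ENNReal.ofReal (a t) ^ (q - 1)) ^ p) ^ (1 / p) :=
                  ENNReal.lintegral_mul_le_Lp_mul_Lq _ hpq
                    (ENNReal.measurable_ofReal.comp
                      ((matMeasurable_const (W x)).mul hWm.inv).matNorm).aemeasurable
                    ((ENNReal.measurable_ofReal.comp ham).pow_const _).aemeasurable
              _ = _ := by simp only [← ENNReal.rpow_mul, hqp]; rfl
          have h2 := ENNReal.rpow_le_rpow h1 hp0.le
          rw [ENNReal.mul_rpow_of_nonneg _ _ hp0.le, ← ENNReal.rpow_mul, ← ENNReal.rpow_mul,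
            one_div_mul_cancel hp0.ne', ENNReal.rpow_one] at h2
          convert h2 using 3
          rw [hq]; field_simp
      _ ≤ _ := by
          rw [lintegral_mul_const' _ _ hIt]
          gcongr
  have hVv : ENNReal.ofReal ‖mApp (V K) v‖ * K.evol ^ (1 / p) ≤
      ENNReal.ofReal c₂ * (apNorm p W ^ (1 / p) * K.evol * I ^ (1 / p)) := by
    have h1 := ENNReal.rpow_le_rpow ((norm_mApp_rpow_mul_evol_le hp0 hV K v).trans
      (mul_le_mul_right hWv _)) (by positivity : 0 ≤ 1 / p)
    simp only [ENNReal.mul_rpow_of_nonneg _ _ (by positivity : 0 ≤ 1 / p), ← ENNReal.rpow_mul,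
      mul_one_div_cancel hp0.ne', ENNReal.rpow_one] at h1
    exact h1
  have hVv2 : ENNReal.ofReal ‖mApp (V K) v‖ ≤
      ENNReal.ofReal c₂ * (apNorm p W ^ (1 / p) * K.evol ^ (1 / q) * I ^ (1 / p)) := by
    have hz : K.evol ^ (1 / p) ≠ 0 := by simp [K.evol_ne_zero, K.evol_ne_top]
    have ht : K.evol ^ (1 / p) ≠ ⊤ := by simp [K.evol_ne_zero, K.evol_ne_top]
    refine (ENNReal.mul_le_mul_iff_left hz ht).1 (hVv.trans (le_of_eq ?_))
    have : K.evol = K.evol ^ (1 / q) * K.evol ^ (1 / p) := by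
      rw [← ENNReal.rpow_add _ _ K.evol_ne_zero K.evol_ne_top, ← hqq]; simp
    conv_lhs => rw [this]
    ring
  have hfinal := ENNReal.le_rpow_of_le_mul_rpow hq1 hIt (B := ENNReal.ofReal ‖mApp (V K)⁻¹ e‖ *
    (ENNReal.ofReal c₂ * (apNorm p W ^ (1 / p) * K.evol ^ (1 / q)))) (by
      rw [hqq]
      calc I ≤ _ := hIv.trans (mul_le_mul_right hVv2 _)
        _ = _ := by ring)
  refine hfinal.trans (le_of_eq ?_)
  simp only [ENNReal.mul_rpow_of_nonneg _ _ hq0.le, ← ENNReal.rpow_mul,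
    ENNReal.mul_rpow_of_nonneg _ _ (by positivity : 0 ≤ 1 / (p - 1)),
    one_div_mul_cancel hq0.ne', ENNReal.rpow_one]
  have e1 : 1 / p * q = 1 / (p - 1) := by rw [hq]; field_simp
  have e2 : p * (1 / (p - 1)) = q := by rw [hq]; field_simp
  rw [e1, e2]
  ring

lemma lintegral_matNorm_inv_mul_le (hp : 1 < p) (hWm : MatMeasurable W)
    (hW : ∀ᵐ x ∂(volume : Measure (Fin d → ℝ)), (W x).PosDef) (hA : apNorm p W < ⊤)
    (hV : IsReducing p c₁ c₂ W V) (K : DCube d) :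
    ∫⁻ x in K.set, ENNReal.ofReal (matNorm ((W x)⁻¹ * V K)) ^ (p / (p - 1)) ≤
      (n : ℝ≥0∞) ^ (p / (p - 1)) * (ENNReal.ofReal c₂ ^ p * apNorm p W) ^ (1 / (p - 1)) *
        K.evol := by
  have hpq : (p / (p - 1)).HolderConjugate p := (Real.HolderConjugate.conjExponent hp).symm
  set q := p / (p - 1)
  refine (lintegral_matNorm_le_sum hpq.lt.le (hWm.inv.mul (matMeasurable_const _)) K).trans ?_
  rcases eq_or_ne n 0 with rfl | hn
  · simp
  calc _ ≤ (n : ℝ≥0∞) ^ (q - 1) * ∑ i : Fin n,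
        (ENNReal.ofReal c₂ ^ p * apNorm p W) ^ (1 / (p - 1)) * K.evol := by
        gcongr with i
        simp only [mApp_mul]
        refine (lintegral_mApp_inv_rpow_le hp hWm hW hA hV K _).trans (le_of_eq ?_)
        rw [← mApp_mul, (hV K).1.inv_mul_self, mApp_one]
        simp
    _ = _ := by
        rw [Finset.sum_const, Finset.card_univ, Fintype.card_fin, nsmul_eq_mul]
        conv_rhs => rw [← sub_add_cancel q 1, ENNReal.rpow_add _ _ (by simpa) (by simp),
          ENNReal.rpow_one]
        ring

end DCube

namespace DCube

section HaarSum

variable {d n : ℕ}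

/-- The part of the Haar multiplier `∑ V_I⁻¹ f_I h_I` coming from the cubes `I ⊆ K` of the first
`m` generations below `K`. -/
def haarSum (V : DCube d → Matrix (Fin n) (Fin n) ℂ)
    (f : (Fin d → ℝ) → EuclideanSpace ℂ (Fin n)) :
    ℕ → DCube d → (Fin d → ℝ) → EuclideanSpace ℂ (Fin n)
  | 0, _, _ => 0
  | m + 1, K, x =>
    mApp (V K)⁻¹ ((K.kid x).avg f - K.avg f) + haarSum V f m (K.kid x) x

variable {V : DCube d → Matrix (Fin n) (Fin n) ℂ} {f G : (Fin d → ℝ) → EuclideanSpace ℂ (Fin n)}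

lemma measurable_haarSum (m : ℕ) (K : DCube d) : Measurable (haarSum V f m K) := by
  induction m generalizing K with
  | zero => exact measurable_const
  | succ m ih =>
    exact measurable_glue K
      (F := fun s x => mApp (V K)⁻¹ ((K.child s).avg f - K.avg f) + haarSum V f m (K.child s) x)
      fun s => (ih _).const_add _

lemma exists_norm_haarSum_le (m : ℕ) (K : DCube d) : ∃ C, ∀ x, ‖haarSum V f m K x‖ ≤ C := by
  induction m generalizing K with
  | zero => exact ⟨0, fun x => by simp [haarSum]⟩
  | succ m ih =>
    choose C hC using ih
    refine ⟨∑ s, (‖mApp (V K)⁻¹ ((K.child s).avg f - K.avg f)‖ + C (K.child s)), fun x => ?_⟩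
    have h0 : ∀ L, 0 ≤ C L := fun L => (norm_nonneg _).trans (hC L x)
    refine (norm_add_le _ _).trans ((add_le_add_right (hC (K.kid x) x) _).trans ?_)
    exact Finset.single_le_sum (f := fun s => ‖mApp (V K)⁻¹ ((K.child s).avg f - K.avg f)‖ +
      C (K.child s)) (fun s _ => add_nonneg (norm_nonneg _) (h0 _)) (Finset.mem_univ (K.kidSel x))

lemma integrableOn_re_inner_haarSum (hG : Integrable G) (m : ℕ) (K : DCube d)
    (S : Set (Fin d → ℝ)) :
    IntegrableOn (fun x => (inner ℂ (haarSum V f m K x) (G x)).re) S := by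
  obtain ⟨C, hC⟩ := exists_norm_haarSum_le (V := V) (f := f) m K
  refine Integrable.mono' (hG.norm.const_mul C).integrableOn ?_ (Filter.Eventually.of_forall
    fun x => ?_)
  · exact (Complex.continuous_re.comp_aestronglyMeasurable
      ((measurable_haarSum m K).aestronglyMeasurable.inner hG.aestronglyMeasurable)).restrict
  · refine (Complex.abs_re_le_norm _).trans ((norm_inner_le_norm _ _).trans ?_)
    gcongr
    exact hC x

lemma vol_smul_avg {E : Type*} [NormedAddCommGroup E] [NormedSpace ℝ E] (K : DCube d)
    (g : (Fin d → ℝ) → E) : K.vol • K.avg g = ∫ x in K.set, g x := by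
  simp only [avg]
  rw [smul_smul, mul_inv_cancel₀ K.vol_pos.ne', one_smul]

lemma sum_vol_smul_avg_child {E : Type*} [NormedAddCommGroup E] [NormedSpace ℝ E] (K : DCube d)
    {g : (Fin d → ℝ) → E} (hg : Integrable g) :
    ∑ s, (K.child s).vol • (K.child s).avg g = K.vol • K.avg g := by
  simp only [vol_smul_avg]
  exact (setIntegral_eq_sum_child K hg.integrableOn).symm

lemma setIntegral_re_inner_const (hG : Integrable G) (K : DCube d) (v : EuclideanSpace ℂ (Fin n)) :
    ∫ x in K.set, (inner ℂ v (G x)).re = K.vol * (inner ℂ v (K.avg G)).re := by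
  have h1 : ∫ x in K.set, inner ℂ v (G x) = inner ℂ v (∫ x in K.set, G x) :=
    integral_inner hG.integrableOn v
  have h2 : ∫ x in K.set, (inner ℂ v (G x)).re = (∫ x in K.set, inner ℂ v (G x)).re :=
    integral_re (𝕜 := ℂ) (f := fun x => inner ℂ v (G x)) (hG.integrableOn.const_inner v)
  rw [h2, h1, ← vol_smul_avg, inner_smul_right_eq_smul, Complex.smul_re, smul_eq_mul]

lemma setIntegral_re_inner_haarSum_succ (hG : Integrable G) (m : ℕ) (K : DCube d) :
    ∫ x in K.set, (inner ℂ (haarSum V f (m + 1) K x) (G x)).re =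
      ∑ s, ((K.child s).vol *
          (inner ℂ (mApp (V K)⁻¹ ((K.child s).avg f - K.avg f)) ((K.child s).avg G)).re +
        ∫ x in (K.child s).set, (inner ℂ (haarSum V f m (K.child s) x) (G x)).re) := by
  rw [setIntegral_eq_sum_child K (integrableOn_re_inner_haarSum hG _ _ _)]
  refine Finset.sum_congr rfl fun s _ => ?_
  rw [← setIntegral_re_inner_const hG, ← integral_add]
  · refine setIntegral_congr_fun (measurableSet_set _) fun x hx => ?_
    simp only [haarSum, kid_of_mem hx, inner_add_left, Complex.add_re]
  · exact (Integrable.const_inner (𝕜 := ℂ) _ hG.integrableOn).re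
  · exact integrableOn_re_inner_haarSum hG _ _ _

end HaarSum

section Pairing

variable {E : Type*} [NormedAddCommGroup E] [InnerProductSpace ℂ E]

lemma _root_.sum_mul_norm_sub_sq {ι : Type*} [Fintype ι] {w : ι → ℝ} {W : ℝ} {a : ι → E} {b : E}
    (hw : ∑ i, w i = W) (ha : ∑ i, w i • a i = W • b) :
    ∑ i, w i * ‖a i - b‖ ^ 2 = ∑ i, w i * ‖a i‖ ^ 2 - W * ‖b‖ ^ 2 := by
  have h1 : ∑ i, w i * (inner ℂ (a i) b).re = W * ‖b‖ ^ 2 := by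
    have := congrArg (fun v => (inner ℂ v b).re) ha
    simp only [sum_inner, inner_smul_left_eq_smul, Complex.re_sum, Complex.smul_re,
      smul_eq_mul] at this
    rw [this, inner_self_eq_norm_sq_to_K]
    norm_cast
  have h2 : ∀ i, w i * ‖a i - b‖ ^ 2 =
      w i * ‖a i‖ ^ 2 - 2 * (w i * (inner ℂ (a i) b).re) + w i * ‖b‖ ^ 2 := by
    intro i
    rw [@norm_sub_sq ℂ]
    simp only [RCLike.re_eq_complex_re]
    ring
  simp only [h2, Finset.sum_add_distrib, Finset.sum_sub_distrib, ← Finset.mul_sum,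
    ← Finset.sum_mul, h1, hw]
  ring

lemma _root_.le_mul_add_of_forall_pos {x y c a b : ℝ} (hc : 0 ≤ c) (ha : 0 ≤ a) (hb : 0 ≤ b)
    (h : ∀ t, 0 < t → x ≤ c / 2 * (t * a ^ 2 + t⁻¹ * b ^ 2) + y) : x ≤ c * a * b + y := by
  refine le_of_forall_pos_le_add fun ε hε => ?_
  set δ := ε / (c * (a + b) + 1) with hδ
  have hD : 0 < c * (a + b) + 1 := by positivity
  have hδ0 : 0 < δ := by positivity
  have hδε : δ * (c * (a + b)) ≤ ε := by
    have : δ * (c * (a + b) + 1) = ε := div_mul_cancel₀ _ hD.ne'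
    nlinarith
  have h1 := h ((b + δ) / (a + δ)) (by positivity)
  have h2 : (b + δ) / (a + δ) * a ^ 2 ≤ (b + δ) * a := by
    rw [div_mul_eq_mul_div, div_le_iff₀ (by positivity)]
    nlinarith [mul_nonneg (mul_nonneg (add_nonneg hb hδ0.le) ha) hδ0.le]
  have h3 : ((b + δ) / (a + δ))⁻¹ * b ^ 2 ≤ (a + δ) * b := by
    rw [inv_div, div_mul_eq_mul_div, div_le_iff₀ (by positivity)]
    nlinarith [mul_nonneg (mul_nonneg (add_nonneg ha hδ0.le) hb) hδ0.le]
  have h4 : c / 2 * ((b + δ) / (a + δ) * a ^ 2 + ((b + δ) / (a + δ))⁻¹ * b ^ 2) ≤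
      c / 2 * ((b + δ) * a + (a + δ) * b) := by gcongr
  nlinarith

end Pairing

end DCube

namespace DCube

section Bilinear

variable {d n : ℕ} {V : DCube d → Matrix (Fin n) (Fin n) ℂ}
  {f G : (Fin d → ℝ) → EuclideanSpace ℂ (Fin n)}

lemma mApp_sum_smul {ι : Type*} [Fintype ι] (M : Matrix (Fin n) (Fin n) ℂ) (w : ι → ℝ)
    (a : ι → EuclideanSpace ℂ (Fin n)) :
    mApp M (∑ i, w i • a i) = ∑ i, w i • mApp M (a i) := by
  simp only [← mApp_smul]
  exact map_sum _ _ _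

/-- The contribution of one cube to the bilinear form, estimated by the variances of the two
functions over the children of the cube. -/
lemma sum_re_inner_le (hV : ∀ K, (V K).PosDef) (hf : Integrable f) (hG : Integrable G)
    {lam t : ℝ} (hlam : 0 ≤ lam) (ht : 0 < t) {K Q : DCube d}
    (h : matNorm ((V K)⁻¹ * V Q) ≤ lam) :
    ∑ s, (K.child s).vol *
        (inner ℂ (mApp (V K)⁻¹ ((K.child s).avg f - K.avg f)) ((K.child s).avg G)).re ≤
      lam / 2 * (t * (∑ s, (K.child s).vol * ‖(K.child s).avg f‖ ^ 2 - K.vol * ‖K.avg f‖ ^ 2) +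
        t⁻¹ * (∑ s, (K.child s).vol * ‖mApp (V Q)⁻¹ ((K.child s).avg G)‖ ^ 2 -
          K.vol * ‖mApp (V Q)⁻¹ (K.avg G)‖ ^ 2)) := by
  have hzero : ∑ s, (K.child s).vol *
      (inner ℂ (mApp (V K)⁻¹ ((K.child s).avg f - K.avg f)) (K.avg G)).re = 0 := by
    have h1 : ∑ s, (K.child s).vol • ((K.child s).avg f - K.avg f) = 0 := by
      simp only [smul_sub, Finset.sum_sub_distrib, ← Finset.sum_smul, sum_vol_child,
        sum_vol_smul_avg_child K hf, sub_self]
    have h2 := congrArg (fun v => (inner ℂ (mApp (V K)⁻¹ v) (K.avg G)).re) h1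
    simpa only [mApp_sum_smul, sum_inner, inner_smul_left_eq_smul, Complex.re_sum,
      Complex.smul_re, smul_eq_mul, mApp_zero, inner_zero_left, Complex.zero_re] using h2
  rw [← sum_mul_norm_sub_sq (sum_vol_child K) (sum_vol_smul_avg_child K hf),
    ← sum_mul_norm_sub_sq (b := mApp (V Q)⁻¹ (K.avg G)) (sum_vol_child K)
      (by rw [← mApp_smul, ← sum_vol_smul_avg_child K hG, mApp_sum_smul]),
    ← sub_zero (Finset.sum _ _), ← hzero, ← Finset.sum_sub_distrib, Finset.mul_sum,
    Finset.mul_sum, ← Finset.sum_add_distrib, Finset.mul_sum]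
  refine Finset.sum_le_sum fun s _ => ?_
  rw [← mul_sub, ← Complex.sub_re, ← inner_sub_right, ← mApp_sub]
  set a := (K.child s).avg f - K.avg f
  set b := (K.child s).avg G - K.avg G
  have hvol := (K.child s).vol_pos
  have hb : mApp (V K)⁻¹ b = mApp ((V K)⁻¹ * V Q) (mApp (V Q)⁻¹ b) := by
    rw [← mApp_mul, Matrix.mul_assoc, (hV Q).mul_inv_self, Matrix.mul_one]
  have h1 : (inner ℂ (mApp (V K)⁻¹ a) b).re ≤ lam * (‖a‖ * ‖mApp (V Q)⁻¹ b‖) := by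
    rw [inner_mApp_left, (hV K).inv.isHermitian.eq]
    refine (re_inner_le_norm (𝕜 := ℂ) _ _).trans ?_
    calc ‖a‖ * ‖mApp (V K)⁻¹ b‖ ≤ ‖a‖ * (lam * ‖mApp (V Q)⁻¹ b‖) := by
          rw [hb]
          gcongr
          exact (norm_mApp_le _ _).trans (by gcongr)
      _ = _ := by ring
  have h2 : ‖a‖ * ‖mApp (V Q)⁻¹ b‖ ≤ (t * ‖a‖ ^ 2 + t⁻¹ * ‖mApp (V Q)⁻¹ b‖ ^ 2) / 2 := by
    have h3 : 0 ≤ t⁻¹ * (t * ‖a‖ - ‖mApp (V Q)⁻¹ b‖) ^ 2 := by positivity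
    have h4 : t⁻¹ * (t * ‖a‖ - ‖mApp (V Q)⁻¹ b‖) ^ 2 =
        t * ‖a‖ ^ 2 + t⁻¹ * ‖mApp (V Q)⁻¹ b‖ ^ 2 - 2 * (‖a‖ * ‖mApp (V Q)⁻¹ b‖) := by
      field_simp
      ring
    linarith
  calc (K.child s).vol * (inner ℂ (mApp (V K)⁻¹ a) b).re
      ≤ (K.child s).vol * (lam * ((t * ‖a‖ ^ 2 + t⁻¹ * ‖mApp (V Q)⁻¹ b‖ ^ 2) / 2)) := by
        gcongr
        exact h1.trans (by gcongr)
    _ = _ := by ring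

variable {bad : DCube d → DCube d → Prop}

open Classical in
lemma setIntegral_re_inner_haarSum_le (hV : ∀ K, (V K).PosDef) (hf : Integrable f)
    (hG : Integrable G) {lam : ℝ} (hlam : 0 ≤ lam) {Mf Mg : DCube d → ℝ}
    (hMf : ∀ Q, 0 ≤ Mf Q) (hMg : ∀ Q, 0 ≤ Mg Q) (h0 : ∀ L, ¬bad L L)
    (hVV : ∀ K Q, ¬bad K Q → matNorm ((V K)⁻¹ * V Q) ≤ lam)
    (hfK : ∀ K Q, ¬bad K Q → ‖K.avg f‖ ≤ Mf Q)
    (hfC : ∀ K Q, ¬bad K Q → ∀ s, ‖(K.child s).avg f‖ ≤ Mf Q)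
    (hGK : ∀ K Q, ¬bad K Q → ‖mApp (V Q)⁻¹ (K.avg G)‖ ≤ Mg Q)
    (hGC : ∀ K Q, ¬bad K Q → ∀ s, ‖mApp (V Q)⁻¹ ((K.child s).avg G)‖ ≤ Mg Q)
    (m : ℕ) (Q K : DCube d) (hK : ¬bad K Q) {t : ℝ} (ht : 0 < t) :
    ∫ x in K.set, (inner ℂ (haarSum V f m K x) (G x)).re ≤
      lam / 2 * (t * (K.vol * (Mf Q ^ 2 - ‖K.avg f‖ ^ 2)) +
        t⁻¹ * (K.vol * (Mg Q ^ 2 - ‖mApp (V Q)⁻¹ (K.avg G)‖ ^ 2))) +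
        stopSum bad (fun L => lam * Mf L * Mg L * L.vol) m Q K := by
  have hti := inv_pos.mpr ht
  have hsq : ∀ {a b : ℝ}, 0 ≤ a → a ≤ b → 0 ≤ b ^ 2 - a ^ 2 := fun ha hab =>
    sub_nonneg.mpr (pow_le_pow_left₀ ha hab 2)
  induction m generalizing Q K t with
  | zero =>
    have h1 := hsq (norm_nonneg _) (hfK K Q hK)
    have h2 := hsq (norm_nonneg _) (hGK K Q hK)
    have := K.vol_pos
    simp only [haarSum, stopSum, inner_zero_left, Complex.zero_re, integral_zero, add_zero]
    positivity
  | succ m ih =>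
    rw [setIntegral_re_inner_haarSum_succ hG, Finset.sum_add_distrib]
    have hstep := sum_re_inner_le hV hf hG hlam ht (hVV K Q hK)
    have hkid : ∀ s, ∫ x in (K.child s).set, (inner ℂ (haarSum V f m (K.child s) x) (G x)).re ≤
        lam / 2 * (t * ((K.child s).vol * (Mf Q ^ 2 - ‖(K.child s).avg f‖ ^ 2)) +
          t⁻¹ * ((K.child s).vol * (Mg Q ^ 2 - ‖mApp (V Q)⁻¹ ((K.child s).avg G)‖ ^ 2))) +
        ((if bad (K.child s) Q then
            lam * Mf (K.child s) * Mg (K.child s) * (K.child s).vol else 0) +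
          stopSum bad (fun L => lam * Mf L * Mg L * L.vol) m (principal bad Q (K.child s))
            (K.child s)) := by
      intro s
      have hvol := (K.child s).vol_pos
      by_cases hb : bad (K.child s) Q
      · have h1 := hsq (norm_nonneg _) (hfC K Q hK s)
        have h2 := hsq (norm_nonneg _) (hGC K Q hK s)
        have h3 : 0 ≤ lam / 2 * (t * ((K.child s).vol * (Mf Q ^ 2 - ‖(K.child s).avg f‖ ^ 2)) +
          t⁻¹ * ((K.child s).vol * (Mg Q ^ 2 - ‖mApp (V Q)⁻¹ ((K.child s).avg G)‖ ^ 2))) := by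
          positivity
        have h4 := le_mul_add_of_forall_pos (mul_nonneg hlam hvol.le) (hMf (K.child s))
          (hMg (K.child s)) (x := ∫ x in (K.child s).set,
            (inner ℂ (haarSum V f m (K.child s) x) (G x)).re)
          (y := stopSum bad (fun L => lam * Mf L * Mg L * L.vol) m (K.child s) (K.child s))
          fun τ hτ => by
            have hτi := inv_pos.mpr hτ
            refine (ih (K.child s) (K.child s) (h0 _) hτ hτi).trans ?_
            have h5 : (K.child s).vol * (Mf (K.child s) ^ 2 - ‖(K.child s).avg f‖ ^ 2) ≤
                (K.child s).vol * Mf (K.child s) ^ 2 := by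
              gcongr
              exact sub_le_self _ (by positivity)
            have h6 : (K.child s).vol * (Mg (K.child s) ^ 2 -
                ‖mApp (V (K.child s))⁻¹ ((K.child s).avg G)‖ ^ 2) ≤
                (K.child s).vol * Mg (K.child s) ^ 2 := by
              gcongr
              exact sub_le_self _ (by positivity)
            calc _ ≤ lam / 2 * (τ * ((K.child s).vol * Mf (K.child s) ^ 2) +
                  τ⁻¹ * ((K.child s).vol * Mg (K.child s) ^ 2)) + _ := by gcongr
              _ = _ := by ring
        simp only [principal, if_pos hb]
        linarith
      · simpa only [principal, if_neg hb, zero_add] using ih Q (K.child s) hb ht hti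
    refine (add_le_add hstep (Finset.sum_le_sum fun s _ => hkid s)).trans (le_of_eq ?_)
    rw [Finset.sum_add_distrib, ← Finset.mul_sum, Finset.sum_add_distrib, ← Finset.mul_sum,
      ← Finset.mul_sum]
    simp only [mul_sub, Finset.sum_sub_distrib, ← Finset.sum_mul, sum_vol_child, stopSum]
    ring

/-- The sparse domination of the bilinear form of a Haar multiplier. -/
lemma setIntegral_re_inner_haarSum_le_stopSum (hV : ∀ K, (V K).PosDef) (hf : Integrable f)
    (hG : Integrable G) {lam : ℝ} (hlam : 0 ≤ lam) {Mf Mg : DCube d → ℝ}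
    (hMf : ∀ Q, 0 ≤ Mf Q) (hMg : ∀ Q, 0 ≤ Mg Q) (h0 : ∀ L, ¬bad L L)
    (hVV : ∀ K Q, ¬bad K Q → matNorm ((V K)⁻¹ * V Q) ≤ lam)
    (hfK : ∀ K Q, ¬bad K Q → ‖K.avg f‖ ≤ Mf Q)
    (hfC : ∀ K Q, ¬bad K Q → ∀ s, ‖(K.child s).avg f‖ ≤ Mf Q)
    (hGK : ∀ K Q, ¬bad K Q → ‖mApp (V Q)⁻¹ (K.avg G)‖ ≤ Mg Q)
    (hGC : ∀ K Q, ¬bad K Q → ∀ s, ‖mApp (V Q)⁻¹ ((K.child s).avg G)‖ ≤ Mg Q)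
    (m : ℕ) (T : DCube d) :
    ∫ x in T.set, (inner ℂ (haarSum V f m T x) (G x)).re ≤
      lam * Mf T * Mg T * T.vol + stopSum bad (fun L => lam * Mf L * Mg L * L.vol) m T T := by
  have hvol := T.vol_pos
  have := le_mul_add_of_forall_pos (mul_nonneg hlam hvol.le) (hMf T) (hMg T)
    (x := ∫ x in T.set, (inner ℂ (haarSum V f m T x) (G x)).re)
    (y := stopSum bad (fun L => lam * Mf L * Mg L * L.vol) m T T) fun t ht => by
      have hti := inv_pos.mpr ht
      refine (setIntegral_re_inner_haarSum_le hV hf hG hlam hMf hMg h0 hVV hfK hfC hGK hGC m T T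
        (h0 T) ht).trans ?_
      have h5 : T.vol * (Mf T ^ 2 - ‖T.avg f‖ ^ 2) ≤ T.vol * Mf T ^ 2 := by
        gcongr
        exact sub_le_self _ (by positivity)
      have h6 : T.vol * (Mg T ^ 2 - ‖mApp (V T)⁻¹ (T.avg G)‖ ^ 2) ≤ T.vol * Mg T ^ 2 := by
        gcongr
        exact sub_le_self _ (by positivity)
      calc _ ≤ lam / 2 * (t * (T.vol * Mf T ^ 2) + t⁻¹ * (T.vol * Mg T ^ 2)) + _ := by gcongr
        _ = _ := by ring
  linarith

end Bilinear

end DCube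

lemma norm_mApp_conjTranspose_le {n : ℕ} (M : Matrix (Fin n) (Fin n) ℂ)
    (v : EuclideanSpace ℂ (Fin n)) : ‖mApp M.conjTranspose v‖ ≤ matNorm M * ‖v‖ := by
  rcases (norm_nonneg (mApp M.conjTranspose v)).eq_or_lt with h | h
  · rw [← h]
    exact mul_nonneg (matNorm_nonneg _) (norm_nonneg _)
  refine le_of_mul_le_mul_right ?_ h
  calc ‖mApp M.conjTranspose v‖ * ‖mApp M.conjTranspose v‖
      = ‖inner ℂ (mApp M (mApp M.conjTranspose v)) v‖ := by
        rw [inner_mApp_left, inner_self_eq_norm_sq_to_K]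
        simp [sq]
    _ ≤ ‖mApp M (mApp M.conjTranspose v)‖ * ‖v‖ := norm_inner_le_norm _ _
    _ ≤ matNorm M * ‖mApp M.conjTranspose v‖ * ‖v‖ := by
        gcongr
        exact norm_mApp_le _ _
    _ = _ := by ring

lemma matNorm_le_of_forall {n : ℕ} {M : Matrix (Fin n) (Fin n) ℂ} {c : ℝ} (hc : 0 ≤ c)
    (h : ∀ e, ‖mApp M e‖ ≤ c * ‖e‖) : matNorm M ≤ c :=
  ContinuousLinearMap.opNorm_le_bound _ hc h

namespace DCube

section Tools

variable {d n : ℕ}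

lemma lintegral_mul_inv_le {g : (Fin d → ℝ) → ℝ≥0∞} (hg : Measurable g) {c : ℝ≥0∞}
    {Q : DCube d} (h : ∫⁻ x in Q.set, g x ≤ c * Q.evol) :
    ∫⁻ x in Q.set, g x * c⁻¹ ≤ Q.evol := by
  rw [lintegral_mul_const _ hg]
  calc _ ≤ c * Q.evol * c⁻¹ := by gcongr
    _ = c * c⁻¹ * Q.evol := by ring
    _ ≤ 1 * Q.evol := by
        gcongr
        exact ENNReal.mul_inv_le_one c
    _ = _ := one_mul _

lemma lintegral_le_of_lintegral_mul_inv_le {g : (Fin d → ℝ) → ℝ≥0∞} (hg : Measurable g)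
    {b c : ℝ≥0∞} (hb : b ≠ 0) (hbt : b ≠ ⊤) {K : DCube d}
    (h : ∫⁻ x in K.set, g x * c⁻¹ ≤ b * K.evol) :
    ∫⁻ x in K.set, g x ≤ b * c * K.evol := by
  rw [lintegral_mul_const _ hg, ← div_eq_mul_inv, ENNReal.div_le_iff_le_mul
    (Or.inr (ENNReal.mul_ne_top hbt K.evol_ne_top)) (Or.inr (mul_ne_zero hb K.evol_ne_zero))] at h
  exact h.trans (le_of_eq (by ring))

/-- A stopping condition under which the averages of three families of functions stay under
control until the stopping cubes, while the latter cover at most half of the cube. -/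
lemma exists_stopping {g : Fin 3 → DCube d → (Fin d → ℝ) → ℝ≥0∞} {c : Fin 3 → DCube d → ℝ≥0∞}
    (hg : ∀ i Q, Measurable (g i Q)) (hc : ∀ i Q, ∫⁻ x in Q.set, g i Q x ≤ c i Q * Q.evol) :
    ∃ bad : DCube d → DCube d → Prop, (∀ Q, ¬bad Q Q) ∧
      (∀ m Q, 2 * volume (badSet bad m Q Q) ≤ Q.evol) ∧
      ∀ i K Q, ¬bad K Q → ∫⁻ x in K.set, g i Q x ≤ 6 * c i Q * K.evol := by
  set H : DCube d → (Fin d → ℝ) → ℝ≥0∞ := fun Q x => ∑ i, g i Q x * (c i Q)⁻¹ with hH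
  have hHQ : ∀ Q, ∫⁻ x in Q.set, H Q x ≤ 3 * Q.evol := fun Q => by
    simp only [hH]
    rw [lintegral_finsetSum _ fun i _ => (hg i Q).mul_const _]
    refine (Finset.sum_le_sum fun i _ => lintegral_mul_inv_le (hg i Q) (hc i Q)).trans ?_
    simp
  refine ⟨fun K Q => 6 * K.evol < ∫⁻ x in K.set, H Q x, fun Q => ?_, fun m Q => ?_,
    fun i K Q hK => ?_⟩
  · refine not_lt.mpr ((hHQ Q).trans ?_)
    gcongr
    norm_num
  · have h1 := (mul_volume_badSet_le (bad := fun K Q => 6 * K.evol < ∫⁻ x in K.set, H Q x)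
      (c := 6) (Q := Q) (H := H Q) (fun L hL => hL.le) m Q).trans
      ((lintegral_mono_set (badSet_subset m Q Q)).trans (hHQ Q))
    refine (ENNReal.mul_le_mul_iff_right (a := 3) (by norm_num) (by norm_num)).mp ?_
    rw [← mul_assoc]
    norm_num1
    exact h1
  · refine lintegral_le_of_lintegral_mul_inv_le (hg i Q) (by norm_num) (by norm_num)
      (le_trans (lintegral_mono fun x => ?_) (not_lt.mp hK))
    exact Finset.single_le_sum (f := fun i => g i Q x * (c i Q)⁻¹) (fun _ _ => bot_le)
      (Finset.mem_univ i)

lemma lavg_le_of_lintegral_le {K : DCube d} {F : (Fin d → ℝ) → ℝ≥0∞} {b : ℝ≥0∞}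
    (h : ∫⁻ x in K.set, F x ≤ b * K.evol) : K.lavg F ≤ b := by
  rw [← lavg_mul_evol] at h
  exact (ENNReal.mul_le_mul_iff_left K.evol_ne_zero K.evol_ne_top).mp h

lemma evol_eq_mul_child (K : DCube d) (s : Fin d → Bool) :
    K.evol = 2 ^ d * (K.child s).evol := by
  rw [evol, evol, vol_child K s, ENNReal.ofReal_mul (by positivity),
    ENNReal.ofReal_pow (by norm_num), ENNReal.ofReal_ofNat]

lemma lintegral_child_le {K : DCube d} {F : (Fin d → ℝ) → ℝ≥0∞} {b : ℝ≥0∞}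
    (h : ∫⁻ x in K.set, F x ≤ b * K.evol) (s : Fin d → Bool) :
    ∫⁻ x in (K.child s).set, F x ≤ 2 ^ d * b * (K.child s).evol := by
  refine (lintegral_mono_set (K.child_set_subset s)).trans (h.trans (le_of_eq ?_))
  rw [evol_eq_mul_child K s]
  ring

lemma ofReal_norm_avg_le {E : Type*} [NormedAddCommGroup E] [NormedSpace ℝ E] (K : DCube d)
    (g : (Fin d → ℝ) → E) : ENNReal.ofReal ‖K.avg g‖ ≤ K.lavg fun x => ENNReal.ofReal ‖g x‖ := by
  simp only [avg, lavg]
  rw [norm_smul, norm_inv, Real.norm_of_nonneg K.vol_pos.le,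
    ENNReal.ofReal_mul (inv_nonneg.mpr K.vol_pos.le), ENNReal.ofReal_inv_of_pos K.vol_pos, evol]
  gcongr
  simp only [ofReal_norm]
  exact enorm_integral_le_lintegral_enorm _

lemma norm_avg_le {E : Type*} [NormedAddCommGroup E] [NormedSpace ℝ E] {K : DCube d}
    {g : (Fin d → ℝ) → E} {F : (Fin d → ℝ) → ℝ≥0∞} {b : ℝ≥0∞} (hb : b ≠ ⊤)
    (hgF : ∀ x, ENNReal.ofReal ‖g x‖ ≤ F x) (h : ∫⁻ x in K.set, F x ≤ b * K.evol) :
    ‖K.avg g‖ ≤ b.toReal := by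
  rw [← ENNReal.ofReal_le_iff_le_toReal hb]
  exact (ofReal_norm_avg_le K g).trans
    (lavg_le_of_lintegral_le ((lintegral_mono fun x => hgF x).trans h))

lemma mApp_avg (M : Matrix (Fin n) (Fin n) ℂ) (K : DCube d)
    {g : (Fin d → ℝ) → EuclideanSpace ℂ (Fin n)} (hg : Integrable g) :
    mApp M (K.avg g) = K.avg fun x => mApp M (g x) := by
  simp only [avg]
  rw [mApp_smul]
  congr 1
  exact (ContinuousLinearMap.integral_comp_comm (Matrix.toEuclideanCLM (𝕜 := ℂ) (n := Fin n) M)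
    hg.integrableOn).symm

variable {bad : DCube d → DCube d → Prop}

lemma stopSum_nonneg {t : DCube d → ℝ} (ht : ∀ L, 0 ≤ t L) (m : ℕ) (Q K : DCube d) :
    0 ≤ stopSum bad t m Q K := by
  induction m generalizing Q K with
  | zero => exact le_rfl
  | succ m ih =>
    refine Finset.sum_nonneg fun s _ => add_nonneg ?_ (ih _ _)
    split_ifs
    exacts [ht _, le_rfl]

open Classical in
lemma ofReal_stopSum {t : DCube d → ℝ} (ht : ∀ L, 0 ≤ t L) (m : ℕ) (Q K : DCube d) :
    ENNReal.ofReal (stopSum bad t m Q K) =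
      stopSum bad (fun L => ENNReal.ofReal (t L)) m Q K := by
  induction m generalizing Q K with
  | zero => simp [stopSum]
  | succ m ih =>
    simp only [stopSum]
    have h : ∀ s, 0 ≤ if bad (K.child s) Q then t (K.child s) else 0 := fun s => by
      split_ifs
      exacts [ht _, le_rfl]
    rw [ENNReal.ofReal_sum_of_nonneg fun s _ => add_nonneg (h s) (stopSum_nonneg ht _ _ _)]
    refine Finset.sum_congr rfl fun s _ => ?_
    rw [ENNReal.ofReal_add (h s) (stopSum_nonneg ht _ _ _), ih]
    congr 1
    split_ifs <;> simp

lemma stopSum_mul_left (κ : ℝ≥0∞) (t : DCube d → ℝ≥0∞) (m : ℕ) (Q K : DCube d) :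
    stopSum bad (fun L => κ * t L) m Q K = κ * stopSum bad t m Q K := by
  induction m generalizing Q K with
  | zero => simp [stopSum]
  | succ m ih => simp only [stopSum, ih, Finset.mul_sum, mul_add, mul_ite, mul_zero]

end Tools

end DCube

namespace DCube

section Local

variable {d n : ℕ} {p c₁ c₂ : ℝ} {W : (Fin d → ℝ) → Matrix (Fin n) (Fin n) ℂ}
  {V : DCube d → Matrix (Fin n) (Fin n) ℂ} {f : (Fin d → ℝ) → EuclideanSpace ℂ (Fin n)}

/-- If `W⁻¹ V_Q` has small `L^{p'}` average over `K`, then `V_K⁻¹ V_Q` is bounded. -/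
lemma matNorm_inv_mul_le (hp : 1 < p) (hc₁ : 0 < c₁) (hWm : MatMeasurable W)
    (hW : ∀ᵐ x ∂(volume : Measure (Fin d → ℝ)), (W x).PosDef) (hV : IsReducing p c₁ c₂ W V)
    {K Q : DCube d} {D : ℝ≥0∞} (hD : D ≠ ⊤)
    (h : ∫⁻ x in K.set, ENNReal.ofReal (matNorm ((W x)⁻¹ * V Q)) ^ (p / (p - 1)) ≤ D * K.evol) :
    matNorm ((V K)⁻¹ * V Q) ≤ ((ENNReal.ofReal c₁)⁻¹ * D ^ ((p - 1) / p)).toReal := by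
  have hp0 : 0 < p := by linarith
  have hp1 : 0 < p - 1 := by linarith
  have hq : 0 < p / (p - 1) := by positivity
  have hc : (ENNReal.ofReal c₁)⁻¹ ≠ ⊤ := ENNReal.inv_ne_top.mpr (by simpa using hc₁)
  have hfin : (ENNReal.ofReal c₁)⁻¹ * D ^ ((p - 1) / p) ≠ ⊤ :=
    ENNReal.mul_ne_top hc (ENNReal.rpow_ne_top_of_nonneg (by positivity) hD)
  refine matNorm_le_of_forall ENNReal.toReal_nonneg fun e => ?_
  rw [← ENNReal.toReal_ofReal (norm_nonneg e), ← ENNReal.toReal_mul,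
    ← ENNReal.ofReal_le_iff_le_toReal (ENNReal.mul_ne_top hfin ENNReal.ofReal_ne_top)]
  rw [← ENNReal.rpow_le_rpow_iff hq,
    ← ENNReal.mul_le_mul_iff_left K.evol_ne_zero K.evol_ne_top, mApp_mul]
  refine (norm_mApp_inv_rpow_mul_evol_le hp hc₁ hWm hW hV K _).trans ?_
  have h1 : ∫⁻ x in K.set, ENNReal.ofReal ‖mApp (W x)⁻¹ (mApp (V Q) e)‖ ^ (p / (p - 1)) ≤
      D * K.evol * ENNReal.ofReal ‖e‖ ^ (p / (p - 1)) := by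
    calc _ ≤ ∫⁻ x in K.set, ENNReal.ofReal (matNorm ((W x)⁻¹ * V Q)) ^ (p / (p - 1)) *
          ENNReal.ofReal ‖e‖ ^ (p / (p - 1)) := by
          refine lintegral_mono fun x => ?_
          rw [← ENNReal.mul_rpow_of_nonneg _ _ hq.le, ← ENNReal.ofReal_mul (matNorm_nonneg _),
            ← mApp_mul]
          gcongr
          exact norm_mApp_le _ _
      _ ≤ _ := by
          rw [lintegral_mul_const' _ _ (ENNReal.rpow_ne_top_of_nonneg hq.le ENNReal.ofReal_ne_top)]
          gcongr
  rw [ENNReal.mul_rpow_of_nonneg _ _ hq.le, ENNReal.mul_rpow_of_nonneg _ _ hq.le,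
    ← ENNReal.rpow_mul, show (p - 1) / p * (p / (p - 1)) = 1 by field_simp, ENNReal.rpow_one]
  calc _ ≤ (ENNReal.ofReal c₁)⁻¹ ^ (p / (p - 1)) *
        (D * K.evol * ENNReal.ofReal ‖e‖ ^ (p / (p - 1))) := by gcongr
    _ = _ := by ring

/-- The function dual to `W u` in the pairing with `u`. -/
def dualFn (p : ℝ) (W : (Fin d → ℝ) → Matrix (Fin n) (Fin n) ℂ)
    (u : (Fin d → ℝ) → EuclideanSpace ℂ (Fin n)) (x : Fin d → ℝ) : EuclideanSpace ℂ (Fin n) :=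
  ‖mApp (W x) (u x)‖ ^ (p - 2) • mApp (W x).conjTranspose (mApp (W x) (u x))

variable {u : (Fin d → ℝ) → EuclideanSpace ℂ (Fin n)}

lemma re_inner_dualFn (hp : 1 < p) (x : Fin d → ℝ) :
    (inner ℂ (u x) (dualFn p W u x)).re = ‖mApp (W x) (u x)‖ ^ p := by
  rw [dualFn, inner_smul_right_eq_smul, ← inner_mApp_left, Complex.smul_re,
    inner_self_eq_norm_sq_to_K, ← Real.rpow_sub_one_mul_self (norm_nonneg _) hp,
    ← Real.rpow_sub_two_mul_self (norm_nonneg _) hp, smul_eq_mul, mul_assoc, ← sq]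
  norm_cast

lemma norm_mApp_dualFn_le (hp : 1 < p) {B : Matrix (Fin n) (Fin n) ℂ} (hB : B.IsHermitian)
    (x : Fin d → ℝ) :
    ‖mApp B (dualFn p W u x)‖ ≤ matNorm (W x * B) * ‖mApp (W x) (u x)‖ ^ (p - 1) := by
  have h0 : 0 ≤ ‖mApp (W x) (u x)‖ ^ (p - 2) := by positivity
  rw [dualFn, mApp_smul, norm_smul, Real.norm_of_nonneg h0, ← mApp_mul,
    ← Real.rpow_sub_two_mul_self (norm_nonneg _) hp]
  have h1 : B * (W x).conjTranspose = (W x * B).conjTranspose := by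
    rw [Matrix.conjTranspose_mul, hB.eq]
  rw [h1]
  calc _ ≤ ‖mApp (W x) (u x)‖ ^ (p - 2) * (matNorm (W x * B) * ‖mApp (W x) (u x)‖) := by
        gcongr
        exact norm_mApp_conjTranspose_le _ _
    _ = _ := by ring

lemma measurable_dualFn (hWm : MatMeasurable W) (hu : Measurable u) :
    Measurable (dualFn p W u) := by
  have hWs : MatMeasurable fun x => (W x).conjTranspose := fun i j =>
    Complex.continuous_conj.measurable.comp (hWm j i)
  exact ((hWm.mApp hu).norm.pow_const _).smul (hWs.mApp (hWm.mApp hu))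

/-- The functions pairing with a bounded function are integrable on cubes. -/
lemma lintegral_matNorm_mul_rpow_ne_top (hp : 1 < p) (hc₁ : 0 < c₁) (hWm : MatMeasurable W)
    (hV : IsReducing p c₁ c₂ W V) {C : ℝ} (hC : ∀ x, ‖u x‖ ≤ C)
    (B : Matrix (Fin n) (Fin n) ℂ) (K : DCube d) :
    ∫⁻ x in K.set, ENNReal.ofReal (matNorm (W x * B)) *
      ENNReal.ofReal ‖mApp (W x) (u x)‖ ^ (p - 1) ≠ ⊤ := by
  have hp1 : 0 < p - 1 := by linarith
  have h1 := lintegral_matNorm_mul_ne_top hp hc₁ hWm hV 1 K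
  have hct : ENNReal.ofReal (matNorm B) * ENNReal.ofReal C ^ (p - 1) ≠ ⊤ :=
    ENNReal.mul_ne_top ENNReal.ofReal_ne_top
      (ENNReal.rpow_ne_top_of_nonneg hp1.le ENNReal.ofReal_ne_top)
  refine ne_top_of_le_ne_top (ENNReal.mul_ne_top hct h1) ?_
  rw [← lintegral_const_mul' _ _ hct]
  refine lintegral_mono fun x => ?_
  have h2 : ENNReal.ofReal ‖mApp (W x) (u x)‖ ≤
      ENNReal.ofReal (matNorm (W x)) * ENNReal.ofReal C := by
    rw [← ENNReal.ofReal_mul (matNorm_nonneg _)]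
    gcongr
    exact (norm_mApp_le _ _).trans (mul_le_mul_of_nonneg_left (hC x) (matNorm_nonneg _))
  have h3 : ENNReal.ofReal (matNorm (W x * B)) ≤
      ENNReal.ofReal (matNorm (W x)) * ENNReal.ofReal (matNorm B) := by
    rw [← ENNReal.ofReal_mul (matNorm_nonneg _)]
    gcongr
    exact matNorm_mul_le _ _
  calc _ ≤ ENNReal.ofReal (matNorm (W x)) * ENNReal.ofReal (matNorm B) *
        (ENNReal.ofReal (matNorm (W x)) * ENNReal.ofReal C) ^ (p - 1) := by gcongr
    _ = ENNReal.ofReal (matNorm B) * ENNReal.ofReal C ^ (p - 1) *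
        (ENNReal.ofReal (matNorm (W x)) ^ (p - 1) * ENNReal.ofReal (matNorm (W x)) ^ (1 : ℝ)) := by
        rw [ENNReal.mul_rpow_of_nonneg _ _ hp1.le, ENNReal.rpow_one]
        ring
    _ = _ := by
        rw [← ENNReal.rpow_add_of_nonneg _ _ hp1.le zero_le_one, sub_add_cancel, Matrix.mul_one]

end Local

end DCube

namespace DCube

section Local

variable {d n : ℕ} {p c₁ c₂ : ℝ} {W : (Fin d → ℝ) → Matrix (Fin n) (Fin n) ℂ}
  {V : DCube d → Matrix (Fin n) (Fin n) ℂ} {f : (Fin d → ℝ) → EuclideanSpace ℂ (Fin n)}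

lemma integrable_indicator_dualFn (hp : 1 < p) (hc₁ : 0 < c₁) (hWm : MatMeasurable W)
    (hV : IsReducing p c₁ c₂ W V) {u : (Fin d → ℝ) → EuclideanSpace ℂ (Fin n)}
    (hu : Measurable u) {C : ℝ} (hC : ∀ x, ‖u x‖ ≤ C) (T : DCube d) :
    Integrable (T.set.indicator (dualFn p W u)) := by
  rw [integrable_indicator_iff (measurableSet_set _)]
  refine ⟨(measurable_dualFn hWm hu).aestronglyMeasurable, ?_⟩
  refine lt_of_le_of_lt (lintegral_mono fun x => ?_)
    (lintegral_matNorm_mul_rpow_ne_top hp hc₁ hWm hV hC 1 T).lt_top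
  rw [← ofReal_norm, ENNReal.ofReal_rpow_of_nonneg (norm_nonneg _) (by linarith),
    ← ENNReal.ofReal_mul (matNorm_nonneg _)]
  gcongr
  simpa only [mApp_one] using norm_mApp_dualFn_le (u := u) (W := W) hp Matrix.isHermitian_one x

/-- The sparse domination of the `p`-th power of the norm of `W u`, where `u` is the image of `f`
under a Haar multiplier. -/
lemma exists_sparse_le (hp : 1 < p) (hc₁ : 0 < c₁) (hWm : MatMeasurable W)
    (hW : ∀ᵐ x ∂(volume : Measure (Fin d → ℝ)), (W x).PosDef) (hA : apNorm p W < ⊤)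
    (hV : IsReducing p c₁ c₂ W V) (hf : Integrable f) (hfm : Measurable f) (m : ℕ) (T : DCube d) :
    ∃ bad : DCube d → DCube d → Prop,
      (∀ m Q, 2 * volume (badSet bad m Q Q) ≤ Q.evol) ∧
      ∫⁻ x in T.set, ENNReal.ofReal ‖mApp (W x) (haarSum V f m T x)‖ ^ p ≤
        ((ENNReal.ofReal c₁)⁻¹ * (6 * ((n : ℝ≥0∞) ^ (p / (p - 1)) *
          (ENNReal.ofReal c₂ ^ p * apNorm p W) ^ (1 / (p - 1)))) ^ ((p - 1) / p) *
          (2 ^ d * 6) ^ 2) *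
        ∫⁻ x in T.set, (T.lavg (fun x => ENNReal.ofReal ‖f x‖) *
            ENNReal.ofReal (matNorm (W x * (V T)⁻¹)) +
          stopFun bad (fun L x => L.lavg (fun x => ENNReal.ofReal ‖f x‖) *
            ENNReal.ofReal (matNorm (W x * (V L)⁻¹))) m T T x) *
          ENNReal.ofReal ‖mApp (W x) (haarSum V f m T x)‖ ^ (p - 1) := by
  have hp0 : 0 < p := by linarith
  have hp1 : 0 < p - 1 := by linarith
  set u := haarSum V f m T with hu
  have hum : Measurable u := measurable_haarSum m T
  obtain ⟨C, hC⟩ := exists_norm_haarSum_le (V := V) (f := f) m T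
  set G := T.set.indicator (dualFn p W u) with hGdef
  have hG : Integrable G := integrable_indicator_dualFn hp hc₁ hWm hV hum hC T
  set F : (Fin d → ℝ) → ℝ≥0∞ := fun x => ENNReal.ofReal ‖f x‖ with hF
  have hFm : Measurable F := hfm.norm.ennreal_ofReal
  set φ : DCube d → (Fin d → ℝ) → ℝ≥0∞ := fun L x => ENNReal.ofReal (matNorm (W x * (V L)⁻¹))
    with hφ
  have hφm : ∀ L, Measurable (φ L) := fun L =>
    (hWm.mul (matMeasurable_const _)).matNorm.ennreal_ofReal
  set ψ : (Fin d → ℝ) → ℝ≥0∞ := fun x => ENNReal.ofReal ‖mApp (W x) (u x)‖ ^ (p - 1) with hψ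
  have hψm : Measurable ψ := (hWm.mApp hum).norm.ennreal_ofReal.pow_const _
  set D : ℝ≥0∞ := (n : ℝ≥0∞) ^ (p / (p - 1)) *
    (ENNReal.ofReal c₂ ^ p * apNorm p W) ^ (1 / (p - 1)) with hD
  have hDt : D ≠ ⊤ := ENNReal.mul_ne_top
    (ENNReal.rpow_ne_top_of_nonneg (by positivity) (ENNReal.natCast_ne_top n))
    (ENNReal.rpow_ne_top_of_nonneg (by positivity) (ENNReal.mul_ne_top
      (ENNReal.rpow_ne_top_of_nonneg hp0.le ENNReal.ofReal_ne_top) hA.ne))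
  have hFt : ∀ L : DCube d, L.lavg F ≠ ⊤ := fun L =>
    ENNReal.mul_ne_top (ENNReal.inv_ne_top.mpr L.evol_ne_zero) (by
      simpa only [hF, ofReal_norm] using (hf.integrableOn (s := L.set)).2.ne)
  have hGt : ∀ L : DCube d, L.lavg (fun x => φ L x * ψ x) ≠ ⊤ := fun L =>
    ENNReal.mul_ne_top (ENNReal.inv_ne_top.mpr L.evol_ne_zero)
      (lintegral_matNorm_mul_rpow_ne_top hp hc₁ hWm hV hC _ L)
  have hVpd : ∀ K, (V K).PosDef := fun K => (hV K).1
  have hGb : ∀ Q x, ENNReal.ofReal ‖mApp (V Q)⁻¹ (G x)‖ ≤ φ Q x * ψ x := by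
    intro Q x
    by_cases hx : x ∈ T.set
    · rw [hGdef, Set.indicator_of_mem hx, hφ, hψ]
      simp only []
      rw [ENNReal.ofReal_rpow_of_nonneg (norm_nonneg _) hp1.le,
        ← ENNReal.ofReal_mul (matNorm_nonneg _)]
      gcongr
      exact norm_mApp_dualFn_le hp (hVpd Q).inv.isHermitian x
    · rw [hGdef, Set.indicator_of_notMem hx, mApp_zero]
      simp
  obtain ⟨bad, h0, hS, hb⟩ := exists_stopping
    (g := ![fun _ => F, fun Q x => φ Q x * ψ x,
      fun Q x => ENNReal.ofReal (matNorm ((W x)⁻¹ * V Q)) ^ (p / (p - 1))])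
    (c := ![fun Q => Q.lavg F, fun Q => Q.lavg (fun x => φ Q x * ψ x), fun _ => D])
    (by
      intro i Q
      fin_cases i
      · exact hFm
      · exact (hφm Q).mul hψm
      · exact (hWm.inv.mul (matMeasurable_const _)).matNorm.ennreal_ofReal.pow_const _)
    (by
      intro i Q
      fin_cases i
      · exact (lavg_mul_evol Q F).ge
      · exact (lavg_mul_evol Q _).ge
      · exact lintegral_matNorm_inv_mul_le hp hWm hW hA hV Q)
  refine ⟨bad, hS, ?_⟩
  have hbF : ∀ K Q, ¬bad K Q → ∫⁻ x in K.set, F x ≤ 6 * Q.lavg F * K.evol := fun K Q h => hb 0 K Q h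
  have hbG : ∀ K Q, ¬bad K Q → ∫⁻ x in K.set, φ Q x * ψ x ≤
    6 * Q.lavg (fun x => φ Q x * ψ x) * K.evol := fun K Q h => hb 1 K Q h
  have hbV : ∀ K Q, ¬bad K Q → ∫⁻ x in K.set,
    ENNReal.ofReal (matNorm ((W x)⁻¹ * V Q)) ^ (p / (p - 1)) ≤ 6 * D * K.evol :=
    fun K Q h => hb 2 K Q h
  have h2d : (1 : ℝ≥0∞) ≤ 2 ^ d := one_le_pow₀ (by norm_num)
  have hup : ∀ {K : DCube d} {g : (Fin d → ℝ) → ℝ≥0∞} {b : ℝ≥0∞},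
      ∫⁻ x in K.set, g x ≤ b * K.evol → ∫⁻ x in K.set, g x ≤ 2 ^ d * b * K.evol := by
    intro K g b h
    refine h.trans ?_
    rw [mul_assoc]
    exact le_mul_of_one_le_left bot_le h2d
  have h26 : ∀ {b : ℝ≥0∞}, b ≠ ⊤ → (2 : ℝ≥0∞) ^ d * (6 * b) ≠ ⊤ := fun hb =>
    ENNReal.mul_ne_top (ENNReal.pow_ne_top (by norm_num)) (ENNReal.mul_ne_top (by norm_num) hb)
  set Λ := (ENNReal.ofReal c₁)⁻¹ * (6 * D) ^ ((p - 1) / p) with hΛ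
  have hΛt : Λ ≠ ⊤ := ENNReal.mul_ne_top (ENNReal.inv_ne_top.mpr (by simpa using hc₁))
    (ENNReal.rpow_ne_top_of_nonneg (by positivity) (ENNReal.mul_ne_top (by norm_num) hDt))
  have key := setIntegral_re_inner_haarSum_le_stopSum (bad := bad) hVpd hf hG
    (lam := Λ.toReal) (Mf := fun Q => (2 ^ d * (6 * Q.lavg F)).toReal)
    (Mg := fun Q => (2 ^ d * (6 * Q.lavg fun x => φ Q x * ψ x)).toReal)
    ENNReal.toReal_nonneg (fun _ => ENNReal.toReal_nonneg) (fun _ => ENNReal.toReal_nonneg) h0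
    (fun K Q h => matNorm_inv_mul_le hp hc₁ hWm hW hV (ENNReal.mul_ne_top (by norm_num) hDt)
      (hbV K Q h))
    (fun K Q h => norm_avg_le (h26 (hFt Q)) (fun x => le_rfl) (hup (hbF K Q h)))
    (fun K Q h s => norm_avg_le (h26 (hFt Q)) (fun x => le_rfl) (lintegral_child_le (hbF K Q h) s))
    (fun K Q h => by
      rw [mApp_avg _ _ hG]
      exact norm_avg_le (h26 (hGt Q)) (hGb Q) (hup (hbG K Q h)))
    (fun K Q h s => by
      rw [mApp_avg _ _ hG]
      exact norm_avg_le (h26 (hGt Q)) (hGb Q) (lintegral_child_le (hbG K Q h) s)) m T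
  have hterm : ∀ L : DCube d, ENNReal.ofReal (Λ.toReal * (2 ^ d * (6 * L.lavg F)).toReal *
      (2 ^ d * (6 * L.lavg fun x => φ L x * ψ x)).toReal * L.vol) =
      (Λ * (2 ^ d * 6) ^ 2) * (L.lavg F * L.lavg (fun x => φ L x * ψ x) * L.evol) := by
    intro L
    rw [← ENNReal.toReal_mul, ← ENNReal.toReal_mul, ENNReal.ofReal_mul ENNReal.toReal_nonneg,
      ENNReal.ofReal_toReal (ENNReal.mul_ne_top (ENNReal.mul_ne_top hΛt (h26 (hFt L)))
        (h26 (hGt L))), ← evol]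
    ring
  have hnn : ∀ L : DCube d, 0 ≤ Λ.toReal * (2 ^ d * (6 * L.lavg F)).toReal *
      (2 ^ d * (6 * L.lavg fun x => φ L x * ψ x)).toReal * L.vol := fun L =>
    mul_nonneg (mul_nonneg (mul_nonneg ENNReal.toReal_nonneg ENNReal.toReal_nonneg)
      ENNReal.toReal_nonneg) L.vol_pos.le
  have hX : ∫⁻ x in T.set, ENNReal.ofReal ‖mApp (W x) (u x)‖ ^ p =
      ENNReal.ofReal (∫ x in T.set, (inner ℂ (u x) (G x)).re) := by
    have hre : ∀ x ∈ T.set, (inner ℂ (u x) (G x)).re = ‖mApp (W x) (u x)‖ ^ p := fun x hx => by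
      rw [hGdef, Set.indicator_of_mem hx, re_inner_dualFn hp]
    rw [ofReal_integral_eq_lintegral_ofReal (integrableOn_re_inner_haarSum hG m T T.set)]
    · refine setLIntegral_congr_fun (measurableSet_set T) fun x hx => ?_
      simp only [← hu]
      rw [hre x hx, ENNReal.ofReal_rpow_of_nonneg (norm_nonneg _) hp0.le]
    · refine (ae_restrict_iff' (measurableSet_set T)).mpr (Filter.Eventually.of_forall
        fun x hx => ?_)
      simp only [← hu, Pi.zero_apply]
      rw [hre x hx]
      positivity
  refine hX.le.trans ((ENNReal.ofReal_le_ofReal key).trans (le_of_eq ?_))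
  refine Eq.trans ?_ (congrArg (Λ * (2 ^ d * 6) ^ 2 * ·)
    (lintegral_sparse_mul (bad := bad) (c := fun L => L.lavg F) hφm hψm m T)).symm
  rw [ENNReal.ofReal_add (hnn T) (stopSum_nonneg hnn m T T), ofReal_stopSum hnn m T T]
  simp only [hterm]
  rw [stopSum_mul_left, ← mul_add]

end Local

end DCube

namespace DCube

section Local

variable {d n : ℕ} {p c₁ c₂ : ℝ} {W : (Fin d → ℝ) → Matrix (Fin n) (Fin n) ℂ}
  {V : DCube d → Matrix (Fin n) (Fin n) ℂ} {f : (Fin d → ℝ) → EuclideanSpace ℂ (Fin n)}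

/-- The constant in the bound of Haar multipliers. -/
def multConst (d n : ℕ) (p c₁ c₂ : ℝ) : ℝ≥0∞ :=
  (ENNReal.ofReal c₁)⁻¹ ^ p * (6 ^ (p - 1) * ((n : ℝ≥0∞) ^ p * ENNReal.ofReal c₂ ^ p)) *
    ((2 ^ d * 6) ^ 2) ^ p *
    (ENNReal.ofReal (4 * p * 2 ^ p) ^ (p - 1) *
      (2 * ((n : ℝ≥0∞) ^ p * (ENNReal.ofReal c₁)⁻¹ ^ p)) *
    (ENNReal.ofReal ((4 * (p / (p - 1)) / 1) ^ (p / (p - 1) - 1)) * (2 * 1)) ^ (p - 1))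

lemma multConst_ne_top (d n : ℕ) {p c₁ c₂ : ℝ} (hp : 1 < p) (hc₁ : 0 < c₁) :
    multConst d n p c₁ c₂ ≠ ⊤ := by
  have hp0 : 0 ≤ p := by linarith
  have hp1 : 0 ≤ p - 1 := by linarith
  have hc : (ENNReal.ofReal c₁)⁻¹ ≠ ⊤ := ENNReal.inv_ne_top.mpr (by simpa using hc₁)
  unfold multConst
  apply_rules [ENNReal.mul_ne_top, ENNReal.rpow_ne_top_of_nonneg, ENNReal.pow_ne_top,
    ENNReal.ofReal_ne_top, ENNReal.natCast_ne_top, ENNReal.ofNat_ne_top, ENNReal.one_ne_top]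

lemma lintegral_haarSum_le (hn : 0 < n) (hp : 1 < p) (hc₁ : 0 < c₁) (hWm : MatMeasurable W)
    (hW : ∀ᵐ x ∂(volume : Measure (Fin d → ℝ)), (W x).PosDef) (hA : apNorm p W < ⊤)
    (hV : IsReducing p c₁ c₂ W V) (hf : Integrable f) (hfm : Measurable f) (m : ℕ) (T : DCube d) :
    ∫⁻ x in T.set, ENNReal.ofReal ‖mApp (W x) (haarSum V f m T x)‖ ^ p ≤
      multConst d n p c₁ c₂ * apNorm p W ^ p * ∫⁻ x in T.set, ENNReal.ofReal ‖f x‖ ^ p := by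
  have hp0 : 0 < p := by linarith
  have hp1 : 0 < p - 1 := by linarith
  have hA1 := one_le_apNorm hn hp hc₁ hWm hW hV
  have hAr : 1 ≤ (apNorm p W).toReal := by
    rw [← ENNReal.toReal_one]
    exact ENNReal.toReal_mono hA.ne hA1
  obtain ⟨bad, hS, hX⟩ := exists_sparse_le hp hc₁ hWm hW hA hV hf hfm m T
  have hum : Measurable (haarSum V f m T) := measurable_haarSum m T
  obtain ⟨C, hC⟩ := exists_norm_haarSum_le (V := V) (f := f) m T
  set u := haarSum V f m T
  set F : (Fin d → ℝ) → ℝ≥0∞ := fun x => ENNReal.ofReal ‖f x‖ with hF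
  have hFm : Measurable F := hfm.norm.ennreal_ofReal
  have hFt : ∀ L : DCube d, L.lavg F ≠ ⊤ := fun L =>
    ENNReal.mul_ne_top (ENNReal.inv_ne_top.mpr L.evol_ne_zero) (by
      simpa only [hF, ofReal_norm] using (hf.integrableOn (s := L.set)).2.ne)
  set φ : DCube d → (Fin d → ℝ) → ℝ≥0∞ := fun L x => ENNReal.ofReal (matNorm (W x * (V L)⁻¹))
    with hφ
  have hφm : ∀ L, Measurable (φ L) := fun L =>
    (hWm.mul (matMeasurable_const _)).matNorm.ennreal_ofReal
  set ψ : (Fin d → ℝ) → ℝ≥0∞ := fun x => ENNReal.ofReal ‖mApp (W x) (u x)‖ ^ (p - 1) with hψ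
  have hψm : Measurable ψ := (hWm.mApp hum).norm.ennreal_ofReal.pow_const _
  set Sp : (Fin d → ℝ) → ℝ≥0∞ := fun x => T.lavg F * φ T x +
    stopFun bad (fun L x => L.lavg F * φ L x) m T T x with hSp
  have hSpm : Measurable Sp :=
    ((hφm T).const_mul _).add (measurable_stopFun (fun L => (hφm L).const_mul _) m T T)
  set X := ∫⁻ x in T.set, ENNReal.ofReal ‖mApp (W x) (u x)‖ ^ p with hXdef
  have hXt : X ≠ ⊤ := by
    have h1 := lintegral_matNorm_mul_ne_top hp hc₁ hWm hV 1 T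
    have hct : ENNReal.ofReal C ^ p ≠ ⊤ :=
      ENNReal.rpow_ne_top_of_nonneg hp0.le ENNReal.ofReal_ne_top
    refine ne_top_of_le_ne_top (ENNReal.mul_ne_top hct h1) ?_
    rw [← lintegral_const_mul' _ _ hct]
    refine lintegral_mono fun x => ?_
    rw [← ENNReal.mul_rpow_of_nonneg _ _ hp0.le, Matrix.mul_one, mul_comm,
      ← ENNReal.ofReal_mul (matNorm_nonneg _)]
    gcongr
    exact (norm_mApp_le _ _).trans (mul_le_mul_of_nonneg_left (hC x) (matNorm_nonneg _))
  set κ := (ENNReal.ofReal c₁)⁻¹ * (6 * ((n : ℝ≥0∞) ^ (p / (p - 1)) *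
          (ENNReal.ofReal c₂ ^ p * apNorm p W) ^ (1 / (p - 1)))) ^ ((p - 1) / p) *
          (2 ^ d * 6) ^ 2 with hκ
  have hr : 0 < (2 ^ p * (apNorm p W).toReal)⁻¹ := by positivity
  have hr1 : (2 ^ p * (apNorm p W).toReal)⁻¹ ≤ 1 := by
    refine inv_le_one_of_one_le₀ ?_
    have : (1 : ℝ) ≤ 2 ^ p := Real.one_le_rpow (by norm_num) hp0.le
    nlinarith
  have hsp := lintegral_sparse_rpow_le (bad := bad) (c := fun L => L.lavg F) hp.le hr hr1 hφm
    (fun L K E hE hEK hE2 => lintegral_doubling hn hp hc₁ hWm hW hA hV _ K hE hEK hE2) hS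
    (fun L => lintegral_matNorm_mul_inv_le hp hc₁ hWm hV L) m T
  have hcar := carleson_stopSum hp hS hFm hFt m T
  have hhol := ENNReal.lintegral_mul_le_Lp_mul_Lq (volume.restrict T.set)
    (Real.HolderConjugate.conjExponent hp) hSpm.aemeasurable hψm.aemeasurable
  have hψq : ∫⁻ x in T.set, ψ x ^ Real.conjExponent p = X := by
    refine lintegral_congr fun x => ?_
    rw [hψ]
    simp only []
    rw [← ENNReal.rpow_mul, Real.conjExponent]
    congr 1
    field_simp
  simp only [Pi.mul_apply] at hhol
  rw [hψq] at hhol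
  have hmain : X ≤ (κ * (∫⁻ x in T.set, Sp x ^ p) ^ (1 / p)) * X ^ (1 - 1 / p) := by
    have he : 1 / Real.conjExponent p = 1 - 1 / p := by
      rw [Real.conjExponent]
      field_simp
    rw [he] at hhol
    exact hX.trans ((mul_le_mul_right hhol κ).trans (mul_assoc _ _ _).ge)
  have hfin := ENNReal.le_rpow_of_le_mul_rpow hp hXt hmain
  rw [ENNReal.mul_rpow_of_nonneg _ _ hp0.le, ← ENNReal.rpow_mul, one_div_mul_cancel hp0.ne',
    ENNReal.rpow_one] at hfin
  refine hfin.trans ?_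
  have hκp : κ ^ p = (ENNReal.ofReal c₁)⁻¹ ^ p *
      (6 ^ (p - 1) * ((n : ℝ≥0∞) ^ p * ENNReal.ofReal c₂ ^ p)) *
      ((2 ^ d * 6) ^ 2) ^ p * apNorm p W := by
    rw [hκ, ENNReal.mul_rpow_of_nonneg _ _ hp0.le, ENNReal.mul_rpow_of_nonneg _ _ hp0.le,
      ← ENNReal.rpow_mul, div_mul_cancel₀ _ hp0.ne', ENNReal.mul_rpow_of_nonneg _ _ hp1.le,
      ENNReal.mul_rpow_of_nonneg _ _ hp1.le, ← ENNReal.rpow_mul, ← ENNReal.rpow_mul,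
      div_mul_cancel₀ _ hp1.ne', div_mul_cancel₀ _ hp1.ne', ENNReal.rpow_one]
    ring
  have hrp : ENNReal.ofReal ((4 * p / (2 ^ p * (apNorm p W).toReal)⁻¹) ^ (p - 1)) =
      ENNReal.ofReal (4 * p * 2 ^ p) ^ (p - 1) * apNorm p W ^ (p - 1) := by
    rw [div_inv_eq_mul, ← mul_assoc, ← ENNReal.ofReal_rpow_of_nonneg (by positivity) hp1.le,
      ENNReal.ofReal_mul (by positivity), ENNReal.ofReal_toReal hA.ne,
      ENNReal.mul_rpow_of_nonneg _ _ hp1.le]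
  have hAp : apNorm p W ^ p = apNorm p W * apNorm p W ^ (p - 1) := by
    nth_rewrite 2 [← ENNReal.rpow_one (apNorm p W)]
    rw [← ENNReal.rpow_add_of_nonneg _ _ zero_le_one hp1.le]
    congr 1
    ring
  calc κ ^ p * ∫⁻ x in T.set, Sp x ^ p
      ≤ κ ^ p * (ENNReal.ofReal ((4 * p / (2 ^ p * (apNorm p W).toReal)⁻¹) ^ (p - 1)) *
        (2 * ((n : ℝ≥0∞) ^ p * (ENNReal.ofReal c₁)⁻¹ ^ p)) *
        ((ENNReal.ofReal ((4 * (p / (p - 1)) / 1) ^ (p / (p - 1) - 1)) * (2 * 1)) ^ (p - 1) *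
          ∫⁻ x in T.set, F x ^ p)) := by
        gcongr
        exact hsp.trans (by gcongr)
    _ = _ := by
        rw [hκp, hrp, hAp, multConst]
        ring

end Local

end DCube

namespace DCube

section Global

variable {d n : ℕ} {p c₁ c₂ : ℝ} {W : (Fin d → ℝ) → Matrix (Fin n) (Fin n) ℂ}
  {V : DCube d → Matrix (Fin n) (Fin n) ℂ} {f : (Fin d → ℝ) → EuclideanSpace ℂ (Fin n)}

/-- The generation `k` part `∑_{I, ε} V_I⁻¹ f_I^ε h_I^ε(x)` of the Haar multiplier. -/
def haarStep (V : DCube d → Matrix (Fin n) (Fin n) ℂ)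
    (f : (Fin d → ℝ) → EuclideanSpace ℂ (Fin n)) (x : Fin d → ℝ) (k : ℤ) :
    EuclideanSpace ℂ (Fin n) :=
  mApp (V (cubeAt k x))⁻¹ ((cubeAt (k - 1) x).avg f - (cubeAt k x).avg f)

lemma haarSum_cubeAt (m : ℕ) (k : ℤ) (x : Fin d → ℝ) :
    haarSum V f m (cubeAt k x) x = ∑ j ∈ Finset.range m, haarStep V f x (k - j) := by
  induction m generalizing k with
  | zero => simp [haarSum]
  | succ m ih =>
    rw [haarSum, kid_cubeAt, ih, Finset.sum_range_succ', add_comm]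
    congr 1
    · refine Finset.sum_congr rfl fun j _ => ?_
      congr 1
      push_cast
      ring
    · simp [haarStep]

lemma haarSum_cubeAt_eq_sum_Ioc (N : ℕ) (x : Fin d → ℝ) :
    haarSum V f (2 * N) (cubeAt N x) x = ∑ k ∈ Finset.Ioc (-(N : ℤ)) N, haarStep V f x k := by
  rw [haarSum_cubeAt]
  refine Finset.sum_bij' (fun j _ => (N : ℤ) - j) (fun k _ => ((N : ℤ) - k).toNat) ?_ ?_ ?_ ?_ ?_
  all_goals intro j hj
  all_goals simp only [Finset.mem_range, Finset.mem_Ioc] at hj ⊢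
  all_goals omega

lemma projInv_univ_eq_tsum (hf : Integrable f) (x : Fin d → ℝ) :
    projInv V Set.univ f x = ∑' k : ℤ, haarStep V f x k := by
  have hinj : Function.Injective fun k : ℤ => cubeAt k x := fun a b h => congrArg DCube.k h
  unfold projInv
  rw [tsum_univ fun K : DCube d =>
    ∑ ε ∈ Sfin d, haarFn K ε x • mApp (V K)⁻¹ (haarCoef f K ε)]
  simp only [fun K => sum_haarFn_smul_mApp hf (V K)⁻¹ K x]
  rw [← hinj.tsum_eq]
  · refine tsum_congr fun k => ?_
    rw [Set.indicator_of_mem (mem_cubeAt k x), kid_cubeAt, haarStep]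
  · intro K hK
    exact ⟨K.k, (mem_set_iff.1 (Set.mem_of_indicator_ne_zero hK)).symm⟩

lemma ofReal_norm_projInv_le_liminf (hp : 0 < p) (hf : Integrable f) (x : Fin d → ℝ) :
    ENNReal.ofReal ‖mApp (W x) (projInv V Set.univ f x)‖ ^ p ≤
      Filter.liminf (fun N : ℕ => ENNReal.ofReal
        ‖mApp (W x) (haarSum V f (2 * N) (cubeAt N x) x)‖ ^ p) Filter.atTop := by
  rw [projInv_univ_eq_tsum hf]
  by_cases hs : Summable (haarStep V f x)
  · refine (Filter.Tendsto.liminf_eq ?_).ge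
    have ht : Filter.Tendsto (fun N : ℕ => Finset.Ioc (-(N : ℤ)) N) Filter.atTop Filter.atTop := by
      refine Filter.tendsto_atTop_finset_of_monotone
        (fun a b h => Finset.Ioc_subset_Ioc (by simpa using h) (by simpa using h)) fun k => ?_
      exact ⟨k.natAbs + 1, by rw [Finset.mem_Ioc]; omega⟩
    have hc : Continuous fun v : EuclideanSpace ℂ (Fin n) =>
        ENNReal.ofReal ‖mApp (W x) v‖ ^ p := by
      unfold mApp
      exact (ENNReal.continuous_rpow_const).comp
        (ENNReal.continuous_ofReal.comp (ContinuousLinearMap.continuous _).norm)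
    simp only [haarSum_cubeAt_eq_sum_Ioc]
    exact (hc.tendsto _).comp (hs.hasSum.comp ht)
  · rw [tsum_eq_zero_of_not_summable hs, mApp_zero, norm_zero, ENNReal.ofReal_zero,
      ENNReal.zero_rpow_of_pos hp]
    exact bot_le

lemma lintegral_haarSum_cubeAt_le (hn : 0 < n) (hp : 1 < p) (hc₁ : 0 < c₁) (hWm : MatMeasurable W)
    (hW : ∀ᵐ x ∂(volume : Measure (Fin d → ℝ)), (W x).PosDef) (hA : apNorm p W < ⊤)
    (hV : IsReducing p c₁ c₂ W V) (hf : Integrable f) (hfm : Measurable f) (m : ℕ) (k : ℤ) :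
    ∫⁻ x, ENNReal.ofReal ‖mApp (W x) (haarSum V f m (cubeAt k x) x)‖ ^ p ≤
      multConst d n p c₁ c₂ * apNorm p W ^ p * ∫⁻ x, ENNReal.ofReal ‖f x‖ ^ p := by
  rw [lintegral_eq_tsum_cube k fun K x => ENNReal.ofReal ‖mApp (W x) (haarSum V f m K x)‖ ^ p,
    lintegral_eq_tsum_cube k fun _ x => ENNReal.ofReal ‖f x‖ ^ p, ← ENNReal.tsum_mul_left]
  exact ENNReal.tsum_le_tsum fun _ =>
    lintegral_haarSum_le hn hp hc₁ hWm hW hA hV hf hfm m _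

lemma lintegral_projInv_le (hn : 0 < n) (hp : 1 < p) (hc₁ : 0 < c₁) (hWm : MatMeasurable W)
    (hW : ∀ᵐ x ∂(volume : Measure (Fin d → ℝ)), (W x).PosDef) (hA : apNorm p W < ⊤)
    (hV : IsReducing p c₁ c₂ W V) (hf : Integrable f) (hfm : Measurable f) :
    ∫⁻ x, ENNReal.ofReal ‖mApp (W x) (projInv V Set.univ f x)‖ ^ p ≤
      multConst d n p c₁ c₂ * apNorm p W ^ p * ∫⁻ x, ENNReal.ofReal ‖f x‖ ^ p := by
  refine (lintegral_mono fun x => ofReal_norm_projInv_le_liminf (by linarith) hf x).trans ?_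
  refine (lintegral_liminf_le fun N => ?_).trans ?_
  · exact measurable_cubeAt_comp (N : ℤ)
      (F := fun K x => ENNReal.ofReal ‖mApp (W x) (haarSum V f (2 * N) K x)‖ ^ p) fun K =>
        (hWm.mApp (measurable_haarSum (2 * N) K)).norm.ennreal_ofReal.pow_const p
  · refine (Filter.liminf_le_liminf (Filter.Eventually.of_forall fun N =>
      lintegral_haarSum_cubeAt_le hn hp hc₁ hWm hW hA hV hf hfm (2 * N) N)).trans ?_
    rw [Filter.liminf_const]

end Global

end DCube

section FiniteHaar

variable {d n : ℕ} {f : (Fin d → ℝ) → EuclideanSpace ℂ (Fin n)}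

lemma FiniteHaar.measurable (hf : FiniteHaar f) : Measurable f := by
  obtain ⟨F, hF⟩ := hf
  rw [funext hF]
  exact Finset.measurable_sum _ fun q _ => (measurable_haarFn q.1 q.2).smul_const _

lemma FiniteHaar.integrable (hf : FiniteHaar f) : Integrable f := by
  obtain ⟨F, hF⟩ := hf
  rw [funext hF]
  exact integrable_finsetSum _ fun q _ => (integrable_haarFn q.1 q.2).smul_const _

end FiniteHaar

/-- the main lemma.  Let `1 < p < ∞` and let `W` be a matrix `A_p`
weight on `ℝ^d` with reducing operators `V_I`.  Then there is `C = C(p, n, d)` (and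
depending on the comparability constants `c₁, c₂`) such that for every `f` with finite
Haar expansion,
`‖W^{1/p} M_{W,p}^{-1} f‖_{L^p}^p ≤ C ‖W‖_{A_p}^{1 + ⌈p⌉} ‖f‖_{L^p}^p`,
where `M_{W,p}^{-1} f = ∑_{I ∈ 𝒟} ∑_{ε ∈ 𝒮} V_I^{-1} f_I^ε h_I^ε`. -/
theorem statement8 (d n : ℕ) (hd : 0 < d) (hn : 0 < n) (p c₁ c₂ : ℝ)
    (hp : 1 < p) (hc₁ : 0 < c₁) (hc₂ : 0 < c₂) :
    ∃ C : ℝ≥0∞, 0 < C ∧ C < ⊤ ∧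
      ∀ (W1p : (Fin d → ℝ) → Matrix (Fin n) (Fin n) ℂ)
        (V : DCube d → Matrix (Fin n) (Fin n) ℂ)
        (f : (Fin d → ℝ) → EuclideanSpace ℂ (Fin n)),
        MatMeasurable W1p →
        (∀ᵐ x ∂(volume : Measure (Fin d → ℝ)), (W1p x).PosDef) →
        apNorm p W1p < ⊤ →
        IsReducing p c₁ c₂ W1p V →
        FiniteHaar f →
        ∫⁻ x, ENNReal.ofReal ‖mApp (W1p x) (projInv V Set.univ f x)‖ ^ p ≤
          C * apNorm p W1p ^ (1 + (⌈p⌉₊ : ℝ)) * ∫⁻ x, ENNReal.ofReal ‖f x‖ ^ p := by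
  refine ⟨DCube.multConst d n p c₁ c₂ + 1, by positivity,
    ENNReal.add_lt_top.2 ⟨(DCube.multConst_ne_top d n hp hc₁).lt_top, ENNReal.one_lt_top⟩, ?_⟩
  intro W V f hWm hW hA hV hf
  refine (DCube.lintegral_projInv_le hn hp hc₁ hWm hW hA hV hf.integrable hf.measurable).trans ?_
  have hceil : p ≤ 1 + (⌈p⌉₊ : ℝ) := (Nat.le_ceil p).trans (by linarith)
  have h1 := DCube.one_le_apNorm hn hp hc₁ hWm hW hV
  gcongr
  exact le_self_add


end
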